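/- arXiv:1509.09210 — 4 statements merged into one kernel-verified Lean document; each statement's English description precedes it below -/
import Mathlib

section
/- Let α be a positive integer, let p be an α-compatible sequence of length n, let T = T_α(p), and let β = Σ_{i=1}^n p_i. If T' is any tree with U_1(T) = U_1(T'), then T' is a PTE-tree of the form T_α(p') for some α-compatible sequence p' of length n with Σ_{i=1}^n p'_i = β. -/
open scoped Classical

/-- The multiset of sizes of the connected components of a finite graph. -/
noncomputable def componentSizes {V : Type} [Fintype V] (H : SimpleGraph V) : Multiset ℕ :=
  (Finset.univ : Finset H.ConnectedComponent).val.map fun c => Nat.card c.supp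

/-- The `U_k`-polynomial of a graph, encoded as the multiset of partitions
`λ(E \ A)` over all edge subsets `A` with `|A| ≤ k`.  Two graphs have the same
`U_k`-polynomial iff these multisets coincide. -/
noncomputable def UkPoly {V : Type} [Fintype V] (G : SimpleGraph V) (k : ℕ) :
    Multiset (Multiset ℕ) :=
  (G.edgeFinset.powerset.filter fun A => A.card ≤ k).val.map fun A =>
    componentSizes (G.deleteEdges ↑A)

/-- The `U`-polynomial of a graph, encoded as the multiset of partitions
`λ(E \ A)` over all edge subsets `A`. -/
noncomputable def UPoly {V : Type} [Fintype V] (G : SimpleGraph V) :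
    Multiset (Multiset ℕ) :=
  G.edgeFinset.powerset.val.map fun A => componentSizes (G.deleteEdges ↑A)

/-- Vertex type for the tree `T(p,s)`: a central vertex, roots `v_1,…,v_n`, and for
each `i` the extra vertices of `p i` copies of a 4-vertex path and `s i` copies of
a 4-vertex star (3 extra vertices each, the remaining leaf being identified with
the root `v_i`). -/
abbrev Vtx (n : ℕ) (p s : Fin n → ℕ) : Type :=
  Unit ⊕ Fin n ⊕ ((Σ i : Fin n, Fin (p i) × Fin 3) ⊕ (Σ i : Fin n, Fin (s i) × Fin 3))

/-- Edges of `T(p,s)`: the central vertex is joined to each root `v_i`; each copy of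
a 4-vertex path hangs from `v_i` as `v_i — x₀ — x₁ — x₂`; each copy of a 4-vertex
star hangs from `v_i` as `v_i — y₀` with extra leaves `y₁, y₂` adjacent to `y₀`. -/
inductive TRel (n : ℕ) (p s : Fin n → ℕ) : Vtx n p s → Vtx n p s → Prop where
  | core (i : Fin n) :
      TRel n p s (Sum.inl ()) (Sum.inr (Sum.inl i))
  | pathRoot (i : Fin n) (j : Fin (p i)) :
      TRel n p s (Sum.inr (Sum.inl i)) (Sum.inr (Sum.inr (Sum.inl ⟨i, j, 0⟩)))
  | pathEdge (i : Fin n) (j : Fin (p i)) (l : Fin 2) :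
      TRel n p s (Sum.inr (Sum.inr (Sum.inl ⟨i, j, l.castSucc⟩)))
        (Sum.inr (Sum.inr (Sum.inl ⟨i, j, l.succ⟩)))
  | starRoot (i : Fin n) (j : Fin (s i)) :
      TRel n p s (Sum.inr (Sum.inl i)) (Sum.inr (Sum.inr (Sum.inr ⟨i, j, 0⟩)))
  | starEdge (i : Fin n) (j : Fin (s i)) (l : Fin 2) :
      TRel n p s (Sum.inr (Sum.inr (Sum.inr ⟨i, j, 0⟩)))
        (Sum.inr (Sum.inr (Sum.inr ⟨i, j, l.succ⟩)))

/-- The tree `T(p,s)`. -/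
def TpsGraph (n : ℕ) (p s : Fin n → ℕ) : SimpleGraph (Vtx n p s) :=
  SimpleGraph.fromRel (TRel n p s)

/-- The PTE-tree `T_α(p) = T(p, α - p)`. -/
def Ttree (α : ℕ) {n : ℕ} (p : Fin n → ℕ) : SimpleGraph (Vtx n p (fun i => α - p i)) :=
  TpsGraph n p (fun i => α - p i)

/-- `p` is an `α`-compatible sequence: it has length `n ≥ 2` and all entries `≤ α`. -/
def AlphaCompatible (α : ℕ) {n : ℕ} (p : Fin n → ℕ) : Prop :=
  2 ≤ n ∧ ∀ i, p i ≤ α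

/-- `par` and `d` are the parent map and a depth function exhibiting `G` as a tree rooted at `c`;
the root is its own parent. -/
structure IsRootedTree {V : Type} (G : SimpleGraph V) (c : V) (par : V → V) (d : V → ℕ) :
    Prop where
  par_root : par c = c
  depth_par : ∀ u, u ≠ c → d (par u) + 1 = d u
  adj_iff : ∀ x y, G.Adj x y ↔ (x ≠ c ∧ par x = y) ∨ (y ≠ c ∧ par y = x)

/-- The vertices of the subtree hanging from `v`. -/
noncomputable def descendants {V : Type} [Fintype V] (par : V → V) (v : V) : Finset V :=
  Finset.univ.filter fun u => ∃ k, par^[k] u = v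

/-- The number of vertices of the subtree hanging from `v`. -/
noncomputable def subtreeSize {V : Type} [Fintype V] (par : V → V) (v : V) : ℕ :=
  (descendants par v).card

/-- The children of `v` in the tree rooted at `c` with parent map `par`. -/
noncomputable def children {V : Type} [Fintype V] (c : V) (par : V → V) (v : V) : Finset V :=
  Finset.univ.filter fun u => u ≠ c ∧ par u = v

section ParentMap

variable {V : Type} [Fintype V] {par : V → V} {c u v w : V}

theorem mem_descendants : u ∈ descendants par v ↔ ∃ k, par^[k] u = v := by
  simp [descendants]

theorem mem_children : u ∈ children c par v ↔ u ≠ c ∧ par u = v := by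
  simp [children]

theorem self_mem_descendants (par : V → V) (v : V) : v ∈ descendants par v :=
  mem_descendants.2 ⟨0, rfl⟩

theorem mem_descendants_trans (huv : u ∈ descendants par v) (hvw : v ∈ descendants par w) :
    u ∈ descendants par w := by
  obtain ⟨j, rfl⟩ := mem_descendants.1 huv
  obtain ⟨k, rfl⟩ := mem_descendants.1 hvw
  exact mem_descendants.2 ⟨k + j, Function.iterate_add_apply par k j u⟩

theorem mem_descendants_of_par (h : par u ∈ descendants par v) : u ∈ descendants par v :=
  mem_descendants_trans (mem_descendants.2 ⟨1, rfl⟩) h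

theorem eq_or_par_mem_descendants (h : u ∈ descendants par v) :
    u = v ∨ par u ∈ descendants par v := by
  obtain ⟨_ | k, hk⟩ := mem_descendants.1 h
  · exact Or.inl hk
  · exact Or.inr (mem_descendants.2 ⟨k, hk⟩)

/-- Two vertices with a common descendant are comparable. -/
theorem descendants_comparable (hv : u ∈ descendants par v) (hw : u ∈ descendants par w) :
    v ∈ descendants par w ∨ w ∈ descendants par v := by
  obtain ⟨j, rfl⟩ := mem_descendants.1 hv
  obtain ⟨k, rfl⟩ := mem_descendants.1 hw
  rcases le_total j k with h | h
  · left
    refine mem_descendants.2 ⟨k - j, ?_⟩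
    rw [← Function.iterate_add_apply, Nat.sub_add_cancel h]
  · right
    refine mem_descendants.2 ⟨j - k, ?_⟩
    rw [← Function.iterate_add_apply, Nat.sub_add_cancel h]

theorem descendants_subset (h : u ∈ descendants par v) :
    descendants par u ⊆ descendants par v :=
  fun _ hx => mem_descendants_trans hx h

theorem subtreeSize_mono (h : u ∈ descendants par v) : subtreeSize par u ≤ subtreeSize par v :=
  Finset.card_le_card (descendants_subset h)

theorem subtreeSize_pos (par : V → V) (v : V) : 0 < subtreeSize par v :=
  Finset.card_pos.2 ⟨v, self_mem_descendants par v⟩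

/-- A bijection intertwining two parent maps preserves subtree sizes. -/
theorem subtreeSize_equiv {W : Type} [Fintype W] {par' : W → W} (φ : V ≃ W)
    (hφ : ∀ x, φ (par x) = par' (φ x)) (v : V) :
    subtreeSize par' (φ v) = subtreeSize par v := by
  symm
  refine Finset.card_equiv φ fun x => ?_
  have hsemi : Function.Semiconj φ par par' := hφ
  simp only [mem_descendants]
  refine exists_congr fun k => ?_
  rw [← (hsemi.iterate_right k) x, φ.injective.eq_iff]

end ParentMap

namespace IsRootedTree

variable {V : Type} {G : SimpleGraph V} {c : V} {par : V → V} {d : V → ℕ}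

theorem depth_par_le (hT : IsRootedTree G c par d) (u : V) : d (par u) ≤ d u := by
  by_cases h : u = c
  · rw [h, hT.par_root]
  · have := hT.depth_par u h
    omega

theorem adj_par (hT : IsRootedTree G c par d) {u : V} (hu : u ≠ c) : G.Adj u (par u) :=
  (hT.adj_iff _ _).2 (Or.inl ⟨hu, rfl⟩)

/-- Induction from the root towards the leaves. -/
theorem induction (hT : IsRootedTree G c par d) {P : V → Prop} (root : P c)
    (step : ∀ u, u ≠ c → P (par u) → P u) (u : V) : P u := by
  induction hk : d u using Nat.strong_induction_on generalizing u with
  | _ k ih =>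
    by_cases hu : u = c
    · exact hu ▸ root
    · have := hT.depth_par u hu
      exact step u hu (ih (d (par u)) (by omega) _ rfl)

theorem eq_of_par_eq (hT : IsRootedTree G c par d) {u v : V} (hu : u ≠ c) (hv : v ≠ c)
    (h : s(u, par u) = s(v, par v)) : u = v := by
  rcases Sym2.eq_iff.1 h with ⟨h₁, -⟩ | ⟨h₁, h₂⟩
  · exact h₁
  · have h₃ := hT.depth_par u hu
    have h₄ := hT.depth_par v hv
    rw [h₂] at h₃
    rw [← h₁] at h₄
    omega

variable [Fintype V]

theorem depth_le (hT : IsRootedTree G c par d) {u v : V} (h : u ∈ descendants par v) :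
    d v ≤ d u := by
  obtain ⟨k, rfl⟩ := mem_descendants.1 h
  clear h
  induction k with
  | zero => exact le_rfl
  | succ k ih =>
    rw [Function.iterate_succ_apply']
    exact (hT.depth_par_le _).trans ih

theorem par_notMem_descendants (hT : IsRootedTree G c par d) {v : V} (hv : v ≠ c) :
    par v ∉ descendants par v := by
  intro h
  have := hT.depth_le h
  have := hT.depth_par v hv
  omega

theorem descendants_root (hT : IsRootedTree G c par d) : descendants par c = Finset.univ := by
  refine Finset.eq_univ_of_forall (hT.induction (self_mem_descendants par c) ?_)
  exact fun u _ h => mem_descendants_of_par h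

theorem subtreeSize_root (hT : IsRootedTree G c par d) :
    subtreeSize par c = Fintype.card V := by
  rw [subtreeSize, hT.descendants_root, Finset.card_univ]

theorem root_notMem_descendants (hT : IsRootedTree G c par d) {v : V} (hv : v ≠ c) :
    c ∉ descendants par v := by
  intro h
  obtain ⟨k, hk⟩ := mem_descendants.1 h
  rw [Function.iterate_fixed hT.par_root] at hk
  exact hv hk.symm

theorem subtreeSize_lt (hT : IsRootedTree G c par d) {v : V} (hv : v ≠ c) :
    subtreeSize par v < subtreeSize par (par v) := by
  refine Finset.card_lt_card ⟨descendants_subset (mem_descendants.2 ⟨1, rfl⟩), fun h => ?_⟩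
  exact hT.par_notMem_descendants hv (h (self_mem_descendants par _))

theorem eq_of_mem_descendants (hT : IsRootedTree G c par d) {u v : V}
    (h : u ∈ descendants par v) (hs : subtreeSize par u = subtreeSize par v) : u = v := by
  rcases eq_or_par_mem_descendants h with h' | h'
  · exact h'
  · by_cases hu : u = c
    · by_contra hne
      exact hT.root_notMem_descendants (fun hv => hne (hu.trans hv.symm)) (hu ▸ h)
    · have := hT.subtreeSize_lt hu
      have := subtreeSize_mono h'
      omega

/-- The subtree at `v` consists of `v` and the subtrees at its children. -/
theorem subtreeSize_eq (hT : IsRootedTree G c par d) (v : V) :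
    subtreeSize par v = 1 + ∑ u ∈ children c par v, subtreeSize par u := by
  have hset : descendants par v = insert v ((children c par v).biUnion (descendants par)) := by
    ext x
    simp only [Finset.mem_insert, Finset.mem_biUnion, mem_children]
    constructor
    · refine hT.induction (P := fun x => x ∈ descendants par v →
        x = v ∨ ∃ u, (u ≠ c ∧ par u = v) ∧ x ∈ descendants par u) ?_ ?_ x
      · intro h
        left
        by_contra hne
        exact hT.root_notMem_descendants (Ne.symm hne) h
      · intro u hu ih h
        rcases eq_or_par_mem_descendants h with h' | h'
        · exact Or.inl h'
        · right
          rcases ih h' with h'' | ⟨y, hy, h''⟩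
          · exact ⟨u, ⟨hu, h''⟩, self_mem_descendants par u⟩
          · exact ⟨y, hy, mem_descendants_of_par h''⟩
    · rintro (rfl | ⟨u, ⟨-, rfl⟩, h⟩)
      · exact self_mem_descendants par _
      · exact mem_descendants_trans h (mem_descendants.2 ⟨1, rfl⟩)
  rw [subtreeSize, hset, Finset.card_insert_of_notMem, Finset.card_biUnion, add_comm]
  · rfl
  · have key : ∀ u ∈ children c par v, ∀ w ∈ children c par v, u ∈ descendants par w →
        u = w := by
      intro u hu w hw h
      rw [mem_children] at hu hw
      rcases eq_or_par_mem_descendants h with h' | h'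
      · exact h'
      · rw [hu.2, ← hw.2] at h'
        exact absurd h' (hT.par_notMem_descendants hw.1)
    intro u hu w hw hne
    refine Finset.disjoint_left.2 fun x hxu hxw => hne ?_
    rcases descendants_comparable hxu hxw with h | h
    · exact key u hu w hw h
    · exact (key w hw u hu h).symm
  · simp only [Finset.mem_biUnion, mem_children, not_exists, not_and]
    rintro u ⟨hu, rfl⟩
    exact hT.par_notMem_descendants hu

/-- If the subtrees of size `w` have together as many vertices as there are vertices with subtree
size at most `w`, then below a vertex with a larger subtree only the size `w` can occur. -/
theorem subtreeSize_eq_of_child (hT : IsRootedTree G c par d) {w : ℕ}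
    (hw : (Finset.univ.filter fun v => subtreeSize par v ≤ w).card =
      (Finset.univ.filter fun v => subtreeSize par v = w).card * w)
    {u : V} (hu : subtreeSize par u ≤ w) (hpar : w < subtreeSize par (par u)) :
    subtreeSize par u = w := by
  have hsub : (Finset.univ.filter fun v => subtreeSize par v = w).biUnion (descendants par) ⊆
      Finset.univ.filter fun v => subtreeSize par v ≤ w := by
    intro x hx
    simp only [Finset.mem_biUnion, Finset.mem_filter, Finset.mem_univ, true_and] at hx ⊢
    obtain ⟨v, rfl, hx⟩ := hx
    exact subtreeSize_mono hx
  have hcard : ((Finset.univ.filter fun v => subtreeSize par v = w).biUnion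
      (descendants par)).card = (Finset.univ.filter fun v => subtreeSize par v = w).card * w := by
    rw [Finset.card_biUnion]
    · refine Finset.sum_const_nat fun v hv => ?_
      exact (Finset.mem_filter.1 hv).2
    · intro x hx y hy hne
      simp only [Finset.mem_coe, Finset.mem_filter, Finset.mem_univ, true_and] at hx hy
      refine Finset.disjoint_left.2 fun z hzx hzy => hne ?_
      rcases descendants_comparable hzx hzy with h | h
      · exact hT.eq_of_mem_descendants h (hx.trans hy.symm)
      · exact (hT.eq_of_mem_descendants h (hy.trans hx.symm)).symm
  have hmem : u ∈ Finset.univ.filter fun v => subtreeSize par v ≤ w := by simpa using hu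
  rw [← Finset.eq_of_subset_of_card_le hsub (hw.trans hcard.symm).le] at hmem
  simp only [Finset.mem_biUnion, Finset.mem_filter, Finset.mem_univ, true_and] at hmem
  obtain ⟨v, hv, hmem⟩ := hmem
  rcases eq_or_par_mem_descendants hmem with h | h
  · rw [h, hv]
  · have := subtreeSize_mono h
    omega

end IsRootedTree

section ComponentSizes

variable {V : Type} [Fintype V]

theorem componentSizes_of_reachable {H : SimpleGraph V} {c : V} (h : ∀ u, H.Reachable u c) :
    componentSizes H = {Fintype.card V} := by
  have huniv : (Finset.univ : Finset H.ConnectedComponent) = {H.connectedComponentMk c} := by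
    refine (Finset.eq_singleton_iff_unique_mem).2 ⟨Finset.mem_univ _, fun C _ => ?_⟩
    induction C using SimpleGraph.ConnectedComponent.ind with
    | h u => exact SimpleGraph.ConnectedComponent.sound (h u)
  have hsupp : (H.connectedComponentMk c).supp = Set.univ :=
    Set.eq_univ_of_forall fun u => SimpleGraph.ConnectedComponent.sound (h u)
  rw [componentSizes, huniv, Finset.singleton_val, Multiset.map_singleton, hsupp,
    Nat.card_coe_set_eq, Set.ncard_univ, Nat.card_eq_fintype_card]

theorem componentSizes_of_cut {H : SimpleGraph V} {v c : V} {S : Finset V} (hv : v ∈ S)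
    (hc : c ∉ S) (hin : ∀ u ∈ S, H.Reachable u v) (hout : ∀ u, u ∉ S → H.Reachable u c)
    (hcut : ∀ x y, H.Adj x y → x ∈ S → y ∈ S) :
    componentSizes H = {S.card, Fintype.card V - S.card} := by
  have hclosed : ∀ x y, H.Reachable x y → x ∈ S → y ∈ S := by
    rintro x y ⟨p⟩ hx
    induction p with
    | nil => exact hx
    | cons hadj _ ih => exact ih (hcut _ _ hadj hx)
  have hne : H.connectedComponentMk v ≠ H.connectedComponentMk c := fun h =>
    hc (hclosed _ _ (SimpleGraph.ConnectedComponent.exact h) hv)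
  have huniv : (Finset.univ : Finset H.ConnectedComponent) =
      {H.connectedComponentMk v, H.connectedComponentMk c} := by
    refine (Finset.eq_univ_of_forall fun C => ?_).symm
    induction C using SimpleGraph.ConnectedComponent.ind with
    | h u =>
      by_cases hu : u ∈ S
      · simp [SimpleGraph.ConnectedComponent.sound (hin u hu)]
      · simp [SimpleGraph.ConnectedComponent.sound (hout u hu)]
  have hsuppv : (H.connectedComponentMk v).supp = (S : Set V) := by
    ext u
    rw [SimpleGraph.ConnectedComponent.mem_supp_iff, SimpleGraph.ConnectedComponent.eq]
    exact ⟨fun h => hclosed _ _ h.symm hv, hin u⟩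
  have hsuppc : (H.connectedComponentMk c).supp = ((Sᶜ : Finset V) : Set V) := by
    ext u
    rw [SimpleGraph.ConnectedComponent.mem_supp_iff, SimpleGraph.ConnectedComponent.eq,
      Finset.mem_coe, Finset.mem_compl]
    exact ⟨fun h hu => hc (hclosed _ _ h hu), hout u⟩
  rw [componentSizes, huniv, Finset.insert_val_of_notMem (by simpa using hne),
    Finset.singleton_val, Multiset.map_cons, Multiset.map_singleton, hsuppv, hsuppc,
    Nat.card_coe_set_eq, Nat.card_coe_set_eq, Set.ncard_coe_finset, Set.ncard_coe_finset,
    Finset.card_compl]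
  rfl

theorem UkPoly_eq_map (G : SimpleGraph V) (k : ℕ) :
    UkPoly G k = (G.edgeFinset.powerset.filter fun A => A.card ≤ k).val.map
      fun A : Finset (Sym2 V) => componentSizes (G.deleteEdges ↑A) := by
  simp only [UkPoly, Multiset.bind_def, Multiset.pure_def, Multiset.bind_singleton,
    Multiset.map_map, Function.comp_def]

end ComponentSizes

namespace IsRootedTree

variable {V : Type} {G : SimpleGraph V} {c : V} {par : V → V} {d : V → ℕ}

theorem reachable_root (hT : IsRootedTree G c par d) (u : V) : G.Reachable u c :=
  hT.induction (P := fun u => G.Reachable u c) .rfl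
    (fun _ hu ih => (hT.adj_par hu).reachable.trans ih) u

variable [Fintype V]

theorem componentSizes_deleteEdges (hT : IsRootedTree G c par d) {v : V} (hv : v ≠ c) :
    componentSizes (G.deleteEdges {s(v, par v)}) =
      {subtreeSize par v, Fintype.card V - subtreeSize par v} := by
  have hadj : ∀ u, u ≠ c → u ≠ v → (G.deleteEdges {s(v, par v)}).Adj u (par u) := by
    intro u hu huv
    rw [SimpleGraph.deleteEdges_adj]
    exact ⟨hT.adj_par hu, fun h => huv (hT.eq_of_par_eq hu hv h)⟩
  refine componentSizes_of_cut (self_mem_descendants par v) (hT.root_notMem_descendants hv)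
    ?_ ?_ ?_
  · refine hT.induction ?_ ?_
    · exact fun h => absurd h (hT.root_notMem_descendants hv)
    · intro u hu ih h
      by_cases huv : u = v
      · rw [huv]
      · have hpar := (eq_or_par_mem_descendants h).resolve_left huv
        exact (hadj u hu huv).reachable.trans (ih hpar)
  · refine hT.induction (fun _ => .rfl) ?_
    intro u hu ih h
    have huv : u ≠ v := by
      rintro rfl
      exact h (self_mem_descendants par u)
    exact (hadj u hu huv).reachable.trans (ih fun h' => h (mem_descendants_of_par h'))
  · intro x y hxy hx
    rw [SimpleGraph.deleteEdges_adj] at hxy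
    rcases (hT.adj_iff x y).1 hxy.1 with ⟨-, rfl⟩ | ⟨-, rfl⟩
    · refine (eq_or_par_mem_descendants hx).resolve_left fun h => hxy.2 ?_
      rw [h]
      rfl
    · exact mem_descendants_of_par hx

theorem edgeFinset_eq (hT : IsRootedTree G c par d) [Fintype G.edgeSet] :
    G.edgeFinset = (Finset.univ.filter (· ≠ c)).image fun v => s(v, par v) := by
  ext e
  induction e using Sym2.ind with
  | _ x y =>
    rw [SimpleGraph.mem_edgeFinset, SimpleGraph.mem_edgeSet, hT.adj_iff]
    simp only [Finset.mem_image, Finset.mem_filter, Finset.mem_univ, true_and]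
    constructor
    · rintro (⟨hx, rfl⟩ | ⟨hy, rfl⟩)
      · exact ⟨x, hx, rfl⟩
      · exact ⟨y, hy, Sym2.eq_swap⟩
    · rintro ⟨v, hv, h⟩
      rcases Sym2.eq_iff.1 h with ⟨rfl, rfl⟩ | ⟨rfl, rfl⟩
      · exact Or.inl ⟨hv, rfl⟩
      · exact Or.inr ⟨hv, rfl⟩

/-- In a rooted tree, removing the edge above `v` splits off the subtree at `v`. -/
theorem UkPoly_one (hT : IsRootedTree G c par d) :
    UkPoly G 1 = {Fintype.card V} ::ₘ (Finset.univ.filter (· ≠ c)).val.map fun v =>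
      {subtreeSize par v, Fintype.card V - subtreeSize par v} := by
  have hfilter : (G.edgeFinset.powerset.filter fun A => A.card ≤ 1) =
      insert ∅ ((Finset.univ.filter (· ≠ c)).image fun v => {s(v, par v)}) := by
    ext A
    simp only [Finset.mem_filter, Finset.mem_powerset, Finset.mem_insert, Finset.mem_image,
      hT.edgeFinset_eq, Finset.mem_univ, true_and]
    constructor
    · rintro ⟨hA, hcard⟩
      rcases A.eq_empty_or_nonempty with h | ⟨e, he⟩
      · exact Or.inl h
      · right
        obtain ⟨v, hv, rfl⟩ := Finset.mem_image.1 (hA he)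
        refine ⟨v, (Finset.mem_filter.1 hv).2, ?_⟩
        exact (Finset.eq_singleton_iff_unique_mem.2
          ⟨he, fun e he' => Finset.card_le_one.1 hcard e he' _ he⟩).symm
    · rintro (rfl | ⟨v, hv, rfl⟩)
      · exact ⟨Finset.empty_subset _, by simp⟩
      · refine ⟨?_, (Finset.card_singleton _).le⟩
        rw [Finset.singleton_subset_iff]
        exact Finset.mem_image.2 ⟨v, by simpa using hv, rfl⟩
  rw [UkPoly_eq_map, hfilter, Finset.insert_val_of_notMem (by simp), Multiset.map_cons,
    Finset.image_val_of_injOn, Multiset.map_map]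
  · congr 1
    · rw [Finset.coe_empty, SimpleGraph.deleteEdges_empty,
        componentSizes_of_reachable hT.reachable_root]
    · refine Multiset.map_congr rfl fun v hv => ?_
      have hv' : v ≠ c := (Finset.mem_filter.1 hv).2
      rw [Function.comp_apply, Finset.coe_singleton, hT.componentSizes_deleteEdges hv']
  · intro u hu v hv h
    simp only [Finset.coe_filter, Finset.mem_univ, true_and, Set.mem_ofPred_eq] at hu hv
    exact hT.eq_of_par_eq hu hv (Finset.singleton_injective h)

/-- If every proper subtree has at most half of the vertices, then `U_1` determines the
subtree sizes. -/
theorem map_subtreeSize_eq (hT : IsRootedTree G c par d)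
    (hhalf : ∀ v, v ≠ c → 2 * subtreeSize par v ≤ Fintype.card V)
    {V' : Type} [Fintype V'] {G' : SimpleGraph V'} {c' : V'} {par' : V' → V'} {d' : V' → ℕ}
    (hT' : IsRootedTree G' c' par' d')
    (hhalf' : ∀ v, v ≠ c' → 2 * subtreeSize par' v ≤ Fintype.card V')
    (h : UkPoly G 1 = UkPoly G' 1) :
    Fintype.card V = Fintype.card V' ∧
      (Finset.univ.filter (· ≠ c)).val.map (subtreeSize par) =
        (Finset.univ.filter (· ≠ c')).val.map (subtreeSize par') := by
  rw [hT.UkPoly_one, hT'.UkPoly_one] at h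
  have hcard : Fintype.card V = Fintype.card V' := by
    have hmem : ({Fintype.card V} : Multiset ℕ) ∈ {Fintype.card V'} ::ₘ
        (Finset.univ.filter (· ≠ c')).val.map fun v =>
          ({subtreeSize par' v, Fintype.card V' - subtreeSize par' v} : Multiset ℕ) := by
      rw [← h]
      exact Multiset.mem_cons_self _ _
    rcases Multiset.mem_cons.1 hmem with hm | hm
    · exact Multiset.singleton_inj.1 hm
    · obtain ⟨v, -, hv⟩ := Multiset.mem_map.1 hm
      simpa using congrArg Multiset.card hv
  refine ⟨hcard, ?_⟩
  rw [hcard] at h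
  have hmin := congrArg (Multiset.map fun s : Multiset ℕ => s.fold min s.sum)
    ((Multiset.cons_inj_right _).1 h)
  rw [Multiset.map_map, Multiset.map_map] at hmin
  have hfold : ∀ a N : ℕ, 2 * a ≤ N →
      (({a, N - a} : Multiset ℕ).fold min ({a, N - a} : Multiset ℕ).sum) = a := by
    intro a N ha
    simp only [Multiset.insert_eq_cons, Multiset.fold_cons_left, Multiset.fold_singleton,
      Multiset.sum_cons, Multiset.sum_singleton]
    omega
  calc _ = _ := Multiset.map_congr rfl fun v hv =>
        (hfold _ _ (hcard ▸ hhalf v (Finset.mem_filter.1 hv).2)).symm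
    _ = _ := hmin
    _ = _ := Multiset.map_congr rfl fun v hv => hfold _ _ (hhalf' v (Finset.mem_filter.1 hv).2)

end IsRootedTree

namespace SimpleGraph.IsTree

variable {V : Type} {G : SimpleGraph V}

theorem eq_of_adj_of_dist_lt (hG : G.IsTree) {c x y z : V} (hxy : G.Adj x y) (hxz : G.Adj x z)
    (hy : G.dist c y + 1 = G.dist c x) (hz : G.dist c z + 1 = G.dist c x) : y = z := by
  have hpath : ∀ w, G.Adj x w → G.dist c w + 1 = G.dist c x →
      ∃ p : G.Walk c x, p.IsPath ∧ p.penultimate = w := by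
    intro w hadj hw
    obtain ⟨p, hp⟩ := hG.connected.exists_walk_length_eq_dist c w
    refine ⟨p.concat hadj.symm, SimpleGraph.Walk.isPath_of_length_eq_dist _ ?_, by simp⟩
    rw [SimpleGraph.Walk.length_concat, hp, hw]
  obtain ⟨p, hp, rfl⟩ := hpath y hxy hy
  obtain ⟨q, hq, rfl⟩ := hpath z hxz hz
  rw [(hG.existsUnique_path c x).unique hp hq]

theorem exists_adj_dist_lt (hG : G.IsTree) {c x : V} (hx : x ≠ c) :
    ∃ y, G.Adj x y ∧ G.dist c y + 1 = G.dist c x := by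
  obtain ⟨p, hp⟩ := hG.connected.exists_walk_length_eq_dist x c
  cases p with
  | nil => exact absurd rfl hx
  | @cons _ y _ hadj q =>
    refine ⟨y, hadj, ?_⟩
    rw [SimpleGraph.Walk.length_cons, SimpleGraph.dist_comm] at hp
    have hq := SimpleGraph.dist_le q
    rw [SimpleGraph.dist_comm] at hq
    rcases hG.dist_eq_dist_add_one_of_adj c hadj with h | h <;> omega

/-- A tree can be rooted at any vertex. -/
theorem exists_isRootedTree (hG : G.IsTree) (c : V) :
    ∃ par : V → V, IsRootedTree G c par (G.dist c) := by
  choose! f hadj hdist using fun (x : V) (hx : x ≠ c) => hG.exists_adj_dist_lt hx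
  refine ⟨fun x => if x = c then c else f x, by simp, ?_, ?_⟩
  · intro u hu
    simp only [hu, if_false]
    exact hdist u hu
  · have hpar : ∀ x y, G.Adj x y → G.dist c x = G.dist c y + 1 →
        x ≠ c ∧ (if x = c then c else f x) = y := by
      intro x y hxy h
      have hx : x ≠ c := by
        rintro rfl
        simp at h
      refine ⟨hx, ?_⟩
      rw [if_neg hx]
      exact hG.eq_of_adj_of_dist_lt (hadj x hx) hxy (hdist x hx) h.symm
    intro x y
    constructor
    · intro hxy
      rcases hG.dist_eq_dist_add_one_of_adj c hxy with h | h
      · exact Or.inl (hpar x y hxy h)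
      · exact Or.inr (hpar y x hxy.symm h)
    · rintro (⟨hx, rfl⟩ | ⟨hy, rfl⟩)
      · simp only [hx, if_false]
        exact hadj x hx
      · simp only [hy, if_false]
        exact (hadj y hy).symm

/-- Every finite tree can be rooted at a centroid, so that every proper subtree has at most half
of the vertices. -/
theorem exists_isRootedTree_centroid [Fintype V] (hG : G.IsTree) :
    ∃ (c : V) (par : V → V), IsRootedTree G c par (G.dist c) ∧
      ∀ v, v ≠ c → 2 * subtreeSize par v ≤ Fintype.card V := by
  have := hG.connected.nonempty
  obtain ⟨c, -, hc⟩ := Finset.exists_min_image Finset.univ (fun c => ∑ u, G.dist c u)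
    Finset.univ_nonempty
  obtain ⟨par, hT⟩ := hG.exists_isRootedTree c
  refine ⟨c, par, hT, ?_⟩
  refine hT.induction (P := fun v => v ≠ c → 2 * subtreeSize par v ≤ Fintype.card V)
    (fun h => absurd rfl h) ?_
  intro v hv ih _
  by_cases hpc : par v = c
  · have hle : ∀ u, G.dist v u + 2 * (if u ∈ descendants par v then 1 else 0) ≤
        G.dist c u + 1 := by
      have hvc : G.dist c v = 1 := by
        rw [SimpleGraph.dist_eq_one_iff_adj, ← hpc]
        exact (hT.adj_par hv).symm
      refine hT.induction ?_ ?_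
      · rw [if_neg (hT.root_notMem_descendants hv), SimpleGraph.dist_comm, hvc]
        simp
      · intro u hu ihu
        by_cases huv : u = v
        · rw [huv, if_pos (self_mem_descendants par v), SimpleGraph.dist_self, hvc]
        · have hmem : u ∈ descendants par v ↔ par u ∈ descendants par v :=
            ⟨fun h => (eq_or_par_mem_descendants h).resolve_left huv, mem_descendants_of_par⟩
          have hd := hT.depth_par u hu
          have htri := hG.connected.dist_triangle (u := v) (v := par u) (w := u)
          have hone := SimpleGraph.dist_eq_one_iff_adj.2 (hT.adj_par hu).symm
          simp only [hmem]
          omega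
    have hsum := Finset.sum_le_sum fun u (_ : u ∈ Finset.univ) => hle u
    rw [Finset.sum_add_distrib, Finset.sum_add_distrib, ← Finset.mul_sum, Finset.sum_boole] at hsum
    have hmin := hc v (Finset.mem_univ v)
    have hsize : (Finset.univ.filter fun u => u ∈ descendants par v).card = subtreeSize par v := by
      rw [Finset.filter_univ_mem, subtreeSize]
    simp only [hsize, Finset.sum_const, Finset.card_univ, smul_eq_mul, mul_one,
      Nat.cast_id] at hsum
    omega
  · have := hT.subtreeSize_lt hv
    have := ih hpc
    omega

end SimpleGraph.IsTree

namespace IsRootedTree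

variable {V W : Type} {G : SimpleGraph V} {H : SimpleGraph W} {c : V} {r : W} {par : V → V}
  {par' : W → W} {d : V → ℕ} {d' : W → ℕ}

/-- A bijection of the vertices preserving root and parents is an isomorphism. -/
def iso (hT : IsRootedTree G c par d) (hT' : IsRootedTree H r par' d') (φ : V ≃ W)
    (hroot : φ c = r) (hφ : ∀ x, φ (par x) = par' (φ x)) : G ≃g H where
  toEquiv := φ
  map_rel_iff' := by
    intro x y
    rw [hT.adj_iff, hT'.adj_iff]
    simp only [← hroot, ← hφ, φ.injective.eq_iff, ne_eq]

variable [Fintype V] [Fintype W]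

/-- The numbers of vertices with a given subtree size agree once the sizes of proper subtrees do. -/
theorem card_subtreeSize_eq (hT : IsRootedTree G c par d) (hT' : IsRootedTree H r par' d')
    (hcard : Fintype.card V = Fintype.card W)
    (hmap : (Finset.univ.filter (· ≠ c)).val.map (subtreeSize par) =
      (Finset.univ.filter (· ≠ r)).val.map (subtreeSize par'))
    {w : ℕ} (hw : w < Fintype.card V) :
    (Finset.univ.filter fun v => subtreeSize par v = w).card =
      (Finset.univ.filter fun v => subtreeSize par' v = w).card := by
  have hcount := congrArg (Multiset.countP (· = w)) hmap
  rw [Multiset.countP_map, Multiset.countP_map, ← Finset.filter_val, ← Finset.filter_val,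
    Finset.card_val, Finset.card_val, Finset.filter_filter, Finset.filter_filter] at hcount
  convert hcount using 3
  · refine ⟨fun h => ⟨?_, h⟩, fun h => h.2⟩
    rintro rfl
    have := hT.subtreeSize_root
    omega
  · refine ⟨fun h => ⟨?_, h⟩, fun h => h.2⟩
    rintro rfl
    have := hT'.subtreeSize_root
    omega

end IsRootedTree

section ExplicitTree

variable {n : ℕ} {p s : Fin n → ℕ}

/-- The parent map of `T(p,s)` rooted at its central vertex. -/
def TpsParent (n : ℕ) (p s : Fin n → ℕ) : Vtx n p s → Vtx n p s
  | Sum.inl _ => Sum.inl ()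
  | Sum.inr (Sum.inl _) => Sum.inl ()
  | Sum.inr (Sum.inr (Sum.inl ⟨i, _, 0⟩)) => Sum.inr (Sum.inl i)
  | Sum.inr (Sum.inr (Sum.inl ⟨i, j, 1⟩)) => Sum.inr (Sum.inr (Sum.inl ⟨i, j, 0⟩))
  | Sum.inr (Sum.inr (Sum.inl ⟨i, j, 2⟩)) => Sum.inr (Sum.inr (Sum.inl ⟨i, j, 1⟩))
  | Sum.inr (Sum.inr (Sum.inr ⟨i, _, 0⟩)) => Sum.inr (Sum.inl i)
  | Sum.inr (Sum.inr (Sum.inr ⟨i, j, 1⟩)) => Sum.inr (Sum.inr (Sum.inr ⟨i, j, 0⟩))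
  | Sum.inr (Sum.inr (Sum.inr ⟨i, j, 2⟩)) => Sum.inr (Sum.inr (Sum.inr ⟨i, j, 0⟩))

/-- The distance to the central vertex of `T(p,s)`. -/
def TpsDepth (n : ℕ) (p s : Fin n → ℕ) : Vtx n p s → ℕ
  | Sum.inl _ => 0
  | Sum.inr (Sum.inl _) => 1
  | Sum.inr (Sum.inr (Sum.inl ⟨_, _, 0⟩)) => 2
  | Sum.inr (Sum.inr (Sum.inl ⟨_, _, 1⟩)) => 3
  | Sum.inr (Sum.inr (Sum.inl ⟨_, _, 2⟩)) => 4
  | Sum.inr (Sum.inr (Sum.inr ⟨_, _, 0⟩)) => 2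
  | Sum.inr (Sum.inr (Sum.inr ⟨_, _, 1⟩)) => 3
  | Sum.inr (Sum.inr (Sum.inr ⟨_, _, 2⟩)) => 3

/-- Case distinction on the vertices of `T(p,s)`. -/
theorem Vtx.cases {P : Vtx n p s → Prop} (center : P (Sum.inl ()))
    (root : ∀ i, P (Sum.inr (Sum.inl i)))
    (path0 : ∀ i j, P (Sum.inr (Sum.inr (Sum.inl ⟨i, j, 0⟩))))
    (path1 : ∀ i j, P (Sum.inr (Sum.inr (Sum.inl ⟨i, j, 1⟩))))
    (path2 : ∀ i j, P (Sum.inr (Sum.inr (Sum.inl ⟨i, j, 2⟩))))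
    (star0 : ∀ i j, P (Sum.inr (Sum.inr (Sum.inr ⟨i, j, 0⟩))))
    (star1 : ∀ i j, P (Sum.inr (Sum.inr (Sum.inr ⟨i, j, 1⟩))))
    (star2 : ∀ i j, P (Sum.inr (Sum.inr (Sum.inr ⟨i, j, 2⟩)))) (v : Vtx n p s) : P v := by
  rcases v with ⟨⟩ | i | ⟨i, j, l⟩ | ⟨i, j, l⟩
  · exact center
  · exact root i
  · fin_cases l
    · exact path0 i j
    · exact path1 i j
    · exact path2 i j
  · fin_cases l
    · exact star0 i j
    · exact star1 i j
    · exact star2 i j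

theorem sigma_prod_eq_iff {q : Fin n → ℕ} {i i' : Fin n} {j : Fin (q i)} {j' : Fin (q i')}
    {l l' : Fin 3} : (⟨i, j, l⟩ : Σ i, Fin (q i) × Fin 3) = ⟨i', j', l'⟩ ↔
      (⟨i, j⟩ : Σ i, Fin (q i)) = ⟨i', j'⟩ ∧ l = l' := by
  constructor
  · intro h
    cases h
    exact ⟨rfl, rfl⟩
  · rintro ⟨h, rfl⟩
    cases h
    rfl

theorem TRel_iff (x y : Vtx n p s) :
    TRel n p s x y ↔ y ≠ Sum.inl () ∧ TpsParent n p s y = x := by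
  constructor
  · intro h
    cases h with
    | core i => exact ⟨by simp, rfl⟩
    | pathRoot i j => exact ⟨by simp, rfl⟩
    | pathEdge i j l => fin_cases l <;> exact ⟨by simp, rfl⟩
    | starRoot i j => exact ⟨by simp, rfl⟩
    | starEdge i j l => fin_cases l <;> exact ⟨by simp, rfl⟩
  · rintro ⟨hy, rfl⟩
    induction y using Vtx.cases with
    | center => exact absurd rfl hy
    | root i => exact TRel.core i
    | path0 i j => exact TRel.pathRoot i j
    | path1 i j => exact TRel.pathEdge i j 0
    | path2 i j => exact TRel.pathEdge i j 1
    | star0 i j => exact TRel.starRoot i j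
    | star1 i j => exact TRel.starEdge i j 0
    | star2 i j => exact TRel.starEdge i j 1

theorem isRootedTree_TpsGraph (n : ℕ) (p s : Fin n → ℕ) :
    IsRootedTree (TpsGraph n p s) (Sum.inl ()) (TpsParent n p s) (TpsDepth n p s) := by
  have hdepth : ∀ u : Vtx n p s, u ≠ Sum.inl () →
      TpsDepth n p s (TpsParent n p s u) + 1 = TpsDepth n p s u := by
    intro u hu
    induction u using Vtx.cases with
    | center => exact absurd rfl hu
    | _ => rfl
  refine ⟨rfl, hdepth, fun x y => ?_⟩
  rw [TpsGraph, SimpleGraph.fromRel_adj, TRel_iff, TRel_iff]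
  constructor
  · rintro ⟨-, h⟩
    exact h.symm
  · refine fun h => ⟨?_, h.symm⟩
    rintro rfl
    have hx : x ≠ Sum.inl () ∧ TpsParent n p s x = x := h.elim id id
    have := hdepth x hx.1
    rw [hx.2] at this
    omega

theorem subtreeSize_of_children_eq_empty {V : Type} [Fintype V] {G : SimpleGraph V} {c : V}
    {par : V → V} {d : V → ℕ} (hT : IsRootedTree G c par d) {v : V}
    (h : children c par v = ∅) : subtreeSize par v = 1 := by
  rw [hT.subtreeSize_eq, h, Finset.sum_empty, add_zero]

theorem subtreeSize_Tps_path (i : Fin n) (j : Fin (p i)) (l : Fin 3) :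
    subtreeSize (TpsParent n p s) (Sum.inr (Sum.inr (Sum.inl ⟨i, j, l⟩))) = 3 - l := by
  have hT := isRootedTree_TpsGraph n p s
  have h2 : subtreeSize (TpsParent n p s) (Sum.inr (Sum.inr (Sum.inl ⟨i, j, 2⟩))) = 1 := by
    refine subtreeSize_of_children_eq_empty hT (Finset.eq_empty_of_forall_notMem fun x => ?_)
    rw [mem_children]
    induction x using Vtx.cases <;> simp [TpsParent, sigma_prod_eq_iff, -Sigma.mk.injEq]
  have h1 : subtreeSize (TpsParent n p s) (Sum.inr (Sum.inr (Sum.inl ⟨i, j, 1⟩))) = 2 := by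
    have hch : children (Sum.inl ()) (TpsParent n p s) (Sum.inr (Sum.inr (Sum.inl ⟨i, j, 1⟩))) =
        {Sum.inr (Sum.inr (Sum.inl ⟨i, j, 2⟩))} := by
      ext x
      rw [mem_children]
      induction x using Vtx.cases <;> simp [TpsParent, sigma_prod_eq_iff, -Sigma.mk.injEq]
    rw [hT.subtreeSize_eq, hch, Finset.sum_singleton, h2]
  have h0 : subtreeSize (TpsParent n p s) (Sum.inr (Sum.inr (Sum.inl ⟨i, j, 0⟩))) = 3 := by
    have hch : children (Sum.inl ()) (TpsParent n p s) (Sum.inr (Sum.inr (Sum.inl ⟨i, j, 0⟩))) =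
        {Sum.inr (Sum.inr (Sum.inl ⟨i, j, 1⟩))} := by
      ext x
      rw [mem_children]
      induction x using Vtx.cases <;> simp [TpsParent, sigma_prod_eq_iff, -Sigma.mk.injEq]
    rw [hT.subtreeSize_eq, hch, Finset.sum_singleton, h1]
  fin_cases l
  · exact h0
  · exact h1
  · exact h2

theorem subtreeSize_Tps_star (i : Fin n) (j : Fin (s i)) (l : Fin 3) :
    subtreeSize (TpsParent n p s) (Sum.inr (Sum.inr (Sum.inr ⟨i, j, l⟩))) =
      if l = 0 then 3 else 1 := by
  have hT := isRootedTree_TpsGraph n p s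
  have h2 : subtreeSize (TpsParent n p s) (Sum.inr (Sum.inr (Sum.inr ⟨i, j, 2⟩))) = 1 := by
    refine subtreeSize_of_children_eq_empty hT (Finset.eq_empty_of_forall_notMem fun x => ?_)
    rw [mem_children]
    induction x using Vtx.cases <;> simp [TpsParent, sigma_prod_eq_iff, -Sigma.mk.injEq]
  have h1 : subtreeSize (TpsParent n p s) (Sum.inr (Sum.inr (Sum.inr ⟨i, j, 1⟩))) = 1 := by
    refine subtreeSize_of_children_eq_empty hT (Finset.eq_empty_of_forall_notMem fun x => ?_)
    rw [mem_children]
    induction x using Vtx.cases <;> simp [TpsParent, sigma_prod_eq_iff, -Sigma.mk.injEq]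
  have h0 : subtreeSize (TpsParent n p s) (Sum.inr (Sum.inr (Sum.inr ⟨i, j, 0⟩))) = 3 := by
    have hch : children (Sum.inl ()) (TpsParent n p s) (Sum.inr (Sum.inr (Sum.inr ⟨i, j, 0⟩))) =
        {Sum.inr (Sum.inr (Sum.inr ⟨i, j, 1⟩)), Sum.inr (Sum.inr (Sum.inr ⟨i, j, 2⟩))} := by
      ext x
      rw [mem_children]
      induction x using Vtx.cases <;> simp [TpsParent, sigma_prod_eq_iff, -Sigma.mk.injEq]
    rw [hT.subtreeSize_eq, hch, Finset.sum_pair (by simp [sigma_prod_eq_iff, -Sigma.mk.injEq]), h1, h2]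
    rfl
  fin_cases l
  · exact h0
  · exact h1
  · exact h2

theorem subtreeSize_Tps_root (i : Fin n) :
    subtreeSize (TpsParent n p s) (Sum.inr (Sum.inl i)) = 3 * (p i + s i) + 1 := by
  have hT := isRootedTree_TpsGraph n p s
  let g : Fin (p i) ⊕ Fin (s i) → Vtx n p s :=
    Sum.elim (fun j => Sum.inr (Sum.inr (Sum.inl ⟨i, j, 0⟩)))
      (fun j => Sum.inr (Sum.inr (Sum.inr ⟨i, j, 0⟩)))
  have hg : Function.Injective g := by
    rintro (j | j) (k | k) h <;> simp_all [g]
  have hch : children (Sum.inl ()) (TpsParent n p s) (Sum.inr (Sum.inl i)) =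
      Finset.univ.image g := by
    ext x
    simp only [mem_children, Finset.mem_image, Finset.mem_univ, true_and, Sum.exists, g,
      Sum.elim_inl, Sum.elim_inr]
    constructor
    · rintro ⟨hx, h⟩
      induction x using Vtx.cases with
      | path0 i' j =>
        obtain rfl : i' = i := by simpa [TpsParent] using h
        exact Or.inl ⟨j, rfl⟩
      | star0 i' j =>
        obtain rfl : i' = i := by simpa [TpsParent] using h
        exact Or.inr ⟨j, rfl⟩
      | _ => simp [TpsParent] at h hx
    · rintro (⟨j, rfl⟩ | ⟨j, rfl⟩) <;> exact ⟨by simp, rfl⟩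
  rw [hT.subtreeSize_eq, hch, Finset.sum_image hg.injOn, Fintype.sum_sum_type]
  simp only [g, Sum.elim_inl, Sum.elim_inr, subtreeSize_Tps_path, subtreeSize_Tps_star]
  simp
  ring

theorem card_Vtx {α : ℕ} (h : ∀ i, p i + s i = α) :
    Fintype.card (Vtx n p s) = 1 + n * (3 * α + 1) := by
  have hsum : ∑ i, p i + ∑ i, s i = n * α := by
    rw [← Finset.sum_add_distrib, Finset.sum_congr rfl fun i _ => h i]
    simp
  simp only [Fintype.card_sum, Fintype.card_sigma, Fintype.card_prod, Fintype.card_fin,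
    Fintype.card_unit, ← Finset.sum_mul]
  linear_combination 3 * hsum

theorem subtreeSize_Tps_mem {α : ℕ} (h : ∀ i, p i + s i = α) {v : Vtx n p s}
    (hv : v ≠ Sum.inl ()) :
    subtreeSize (TpsParent n p s) v ∈ ({1, 2, 3, 3 * α + 1} : Finset ℕ) := by
  induction v using Vtx.cases with
  | center => exact absurd rfl hv
  | root i => simp [subtreeSize_Tps_root, h]
  | _ => simp [subtreeSize_Tps_path, subtreeSize_Tps_star]

theorem card_subtreeSize_Tps {α w : ℕ} (h : ∀ i, p i + s i = α)
    (hw : w < Fintype.card (Vtx n p s)) :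
    (Finset.univ.filter fun v => subtreeSize (TpsParent n p s) v = w).card =
      n * (if 3 * α + 1 = w then 1 else 0) +
      (∑ i, p i) * ((if 3 = w then 1 else 0) + (if 2 = w then 1 else 0) + if 1 = w then 1 else 0) +
      (∑ i, s i) * ((if 3 = w then 1 else 0) + 2 * if 1 = w then 1 else 0) := by
  have hroot := (isRootedTree_TpsGraph n p s).subtreeSize_root
  rw [Finset.card_filter]
  simp only [Fintype.sum_sum_type, Fintype.sum_sigma, Fintype.sum_prod_type, Fin.sum_univ_three,
    subtreeSize_Tps_root, subtreeSize_Tps_path, subtreeSize_Tps_star, h, Finset.sum_const,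
    Finset.card_univ, Fintype.card_fin, smul_eq_mul, Fintype.card_unit, hroot, hw.ne',
    if_false, ← Finset.sum_mul]
  simp only [Fin.isValue, Fin.val_zero, Fin.val_one, Fin.val_two, Fin.reduceEq, if_true, if_false]
  simp only [Nat.reduceSub]
  ring

end ExplicitTree

theorem Finset.eq_singleton_of_sum_eq_one {ι : Type} {S : Finset ι} {f : ι → ℕ}
    (hf : ∀ i, 0 < f i) (h : ∑ i ∈ S, f i = 1) : ∃ x, S = {x} ∧ f x = 1 := by
  have hcard : S.card • 1 ≤ ∑ i ∈ S, f i := Finset.card_nsmul_le_sum S f 1 fun i _ => hf i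
  have hne : S.card ≠ 0 := by
    intro h0
    rw [Finset.card_eq_zero.1 h0, Finset.sum_empty] at h
    omega
  rw [h, smul_eq_mul] at hcard
  obtain ⟨x, rfl⟩ := Finset.card_eq_one.1 (by omega : S.card = 1)
  exact ⟨x, rfl, by simpa using h⟩

theorem Finset.eq_singleton_or_pair_of_sum_eq_two {ι : Type} {S : Finset ι} {f : ι → ℕ}
    (hf : ∀ i, 0 < f i) (h : ∑ i ∈ S, f i = 2) :
    (∃ x, S = {x} ∧ f x = 2) ∨ (S.card = 2 ∧ ∃ x y, S = {x, y} ∧ f x = 1 ∧ f y = 1) := by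
  have hcard : S.card • 1 ≤ ∑ i ∈ S, f i := Finset.card_nsmul_le_sum S f 1 fun i _ => hf i
  have hne : S.card ≠ 0 := by
    intro h0
    rw [Finset.card_eq_zero.1 h0, Finset.sum_empty] at h
    omega
  rw [h, smul_eq_mul] at hcard
  rcases (by omega : S.card = 1 ∨ S.card = 2) with h1 | h2
  · obtain ⟨x, rfl⟩ := Finset.card_eq_one.1 h1
    exact Or.inl ⟨x, rfl, by simpa using h⟩
  · right
    refine ⟨h2, ?_⟩
    obtain ⟨x, y, hxy, rfl⟩ := Finset.card_eq_two.1 h2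
    rw [Finset.sum_pair hxy] at h
    have hx := hf x
    have hy := hf y
    exact ⟨x, y, rfl, by omega, by omega⟩

namespace IsRootedTree

variable {V : Type} [Fintype V] {G : SimpleGraph V} {c : V} {par : V → V} {d : V → ℕ}

theorem children_eq_empty (hT : IsRootedTree G c par d) {v : V} (hv : subtreeSize par v = 1) :
    children c par v = ∅ := by
  have h := hT.subtreeSize_eq v
  by_contra hne
  obtain ⟨u, hu⟩ := Finset.nonempty_of_ne_empty hne
  have := Finset.single_le_sum (f := subtreeSize par) (fun _ _ => Nat.zero_le _) hu
  have := subtreeSize_pos par u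
  omega

/-- A subtree with three vertices in which the root has one child is a path. -/
theorem exists_path_of_subtreeSize_eq_three (hT : IsRootedTree G c par d) {v : V}
    (hv : subtreeSize par v = 3) (h1 : (children c par v).card = 1) :
    ∃ f : Fin 3 → V, f 0 = v ∧ children c par v = {f 1} ∧ children c par (f 1) = {f 2} ∧
      children c par (f 2) = ∅ := by
  have h := hT.subtreeSize_eq v
  rcases Finset.eq_singleton_or_pair_of_sum_eq_two (S := children c par v)
    (subtreeSize_pos par) (by omega) with ⟨x, hx, hx2⟩ | ⟨h2, -⟩
  · have h' := hT.subtreeSize_eq x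
    obtain ⟨y, hy, hy1⟩ := Finset.eq_singleton_of_sum_eq_one (S := children c par x)
      (subtreeSize_pos par) (by omega)
    exact ⟨![v, x, y], rfl, hx, hy, hT.children_eq_empty hy1⟩
  · omega

/-- A subtree with three vertices in which the root has not just one child is a star. -/
theorem exists_star_of_subtreeSize_eq_three (hT : IsRootedTree G c par d) {v : V}
    (hv : subtreeSize par v = 3) (h1 : (children c par v).card ≠ 1) :
    ∃ f : Fin 3 → V, f 0 = v ∧ children c par v = {f 1, f 2} ∧ children c par (f 1) = ∅ ∧
      children c par (f 2) = ∅ := by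
  have h := hT.subtreeSize_eq v
  rcases Finset.eq_singleton_or_pair_of_sum_eq_two (S := children c par v)
    (subtreeSize_pos par) (by omega) with ⟨x, hx, -⟩ | ⟨-, x, y, hxy, hx, hy⟩
  · rw [hx] at h1
    exact absurd (Finset.card_singleton x) h1
  · exact ⟨![v, x, y], rfl, hxy, hT.children_eq_empty hx, hT.children_eq_empty hy⟩

/-- If all children of `v` have subtrees of the same size, this size determines their number. -/
theorem card_children_mul (hT : IsRootedTree G c par d) {v : V} {w : ℕ}
    (h : ∀ u ∈ children c par v, subtreeSize par u = w) :
    subtreeSize par v = 1 + (children c par v).card * w := by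
  rw [hT.subtreeSize_eq, Finset.sum_const_nat h]

/-- A rooted tree whose two upper levels are regular with subtrees of sizes `3 * α + 1` and `3`
has the shape of a PTE-tree. -/
theorem exists_equiv_Vtx (hT : IsRootedTree G c par d) {α n : ℕ}
    (hcard : Fintype.card V = 1 + n * (3 * α + 1))
    (hroot : ∀ u ∈ children c par c, subtreeSize par u = 3 * α + 1)
    (hlevel : ∀ v ∈ children c par c, ∀ u ∈ children c par v, subtreeSize par u = 3) :
    ∃ p : Fin n → ℕ, (∀ i, p i ≤ α) ∧ ∃ φ : Vtx n p (fun i => α - p i) ≃ V,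
      φ (Sum.inl ()) = c ∧ ∀ x, φ (TpsParent n p (fun i => α - p i) x) = par (φ x) := by
  have hn : (children c par c).card = n := by
    have h := hT.card_children_mul hroot
    rw [hT.subtreeSize_root, hcard] at h
    exact (Nat.eq_of_mul_eq_mul_right (Nat.succ_pos _) (Nat.add_left_cancel h)).symm
  have hα : ∀ v ∈ children c par c, (children c par v).card = α := by
    intro v hv
    have h := hT.card_children_mul (hlevel v hv)
    rw [hroot v hv] at h
    omega
  let r : Fin n → V := fun i => ((children c par c).equivFinOfCardEq hn).symm i
  have hr : ∀ i, r i ∈ children c par c := fun i =>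
    (((children c par c).equivFinOfCardEq hn).symm i).2
  have hr_surj : ∀ v ∈ children c par c, ∃ i, r i = v := fun v hv =>
    ⟨(children c par c).equivFinOfCardEq hn ⟨v, hv⟩, by simp [r]⟩
  let paths : Fin n → Finset V := fun i =>
    (children c par (r i)).filter fun v => (children c par v).card = 1
  let stars : Fin n → Finset V := fun i =>
    (children c par (r i)).filter fun v => ¬ (children c par v).card = 1
  have hsplit : ∀ i, (paths i).card + (stars i).card = α := fun i => by
    rw [Finset.card_filter_add_card_filter_not, hα _ (hr i)]
  have hstars : ∀ i, (stars i).card = α - (paths i).card := fun i => by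
    have := hsplit i
    omega
  let e : ∀ i, Fin (paths i).card ≃ paths i := fun i => (paths i).equivFin.symm
  let f : ∀ i, Fin (α - (paths i).card) ≃ stars i := fun i =>
    ((stars i).equivFinOfCardEq (hstars i)).symm
  have he : ∀ i j, ((e i j : V) ∈ children c par (r i)) ∧
      (children c par (e i j : V)).card = 1 := fun i j => Finset.mem_filter.1 (e i j).2
  have hf : ∀ i j, ((f i j : V) ∈ children c par (r i)) ∧
      (children c par (f i j : V)).card ≠ 1 := fun i j => Finset.mem_filter.1 (f i j).2
  choose P hP0 hP1 hP2 hP3 using fun i j =>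
    hT.exists_path_of_subtreeSize_eq_three (hlevel _ (hr i) _ (he i j).1) (he i j).2
  choose S hS0 hS1 hS2 hS3 using fun i j =>
    hT.exists_star_of_subtreeSize_eq_three (hlevel _ (hr i) _ (hf i j).1) (hf i j).2
  let φ : Vtx n (fun i => (paths i).card) (fun i => α - (paths i).card) → V :=
    Sum.elim (fun _ => c) (Sum.elim r (Sum.elim (fun x => P x.1 x.2.1 x.2.2)
      (fun x => S x.1 x.2.1 x.2.2)))
  have hpar : ∀ {u v}, u ∈ children c par v → v = par u := fun h => (mem_children.1 h).2.symm
  have hφ : ∀ x, φ (TpsParent n _ _ x) = par (φ x) := by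
    intro x
    induction x using Vtx.cases with
    | center => exact hT.par_root.symm
    | root i => exact hpar (hr i)
    | path0 i j => exact (hpar (he i j).1).trans (congrArg par (hP0 i j).symm)
    | path1 i j => exact (hP0 i j).trans (hpar (by simp [φ, hP1]))
    | path2 i j => exact hpar (u := P i j 2) (v := P i j 1) (by simp [hP2])
    | star0 i j => exact (hpar (hf i j).1).trans (congrArg par (hS0 i j).symm)
    | star1 i j => exact (hS0 i j).trans (hpar (by simp [φ, hS1]))
    | star2 i j => exact (hS0 i j).trans (hpar (by simp [φ, hS1]))
  have hsurj : Function.Surjective φ := by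
    refine hT.induction ⟨Sum.inl (), rfl⟩ ?_
    rintro u hu ⟨x, hx⟩
    have hmem : u ∈ children c par (φ x) := mem_children.2 ⟨hu, hx.symm⟩
    induction x using Vtx.cases with
    | center =>
      obtain ⟨i, rfl⟩ := hr_surj u hmem
      exact ⟨Sum.inr (Sum.inl i), rfl⟩
    | root i =>
      by_cases h1 : (children c par u).card = 1
      · obtain ⟨j, hj⟩ := (e i).surjective ⟨u, Finset.mem_filter.2 ⟨hmem, h1⟩⟩
        exact ⟨Sum.inr (Sum.inr (Sum.inl ⟨i, j, 0⟩)), (hP0 i j).trans (congrArg Subtype.val hj)⟩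
      · obtain ⟨j, hj⟩ := (f i).surjective ⟨u, Finset.mem_filter.2 ⟨hmem, h1⟩⟩
        exact ⟨Sum.inr (Sum.inr (Sum.inr ⟨i, j, 0⟩)), (hS0 i j).trans (congrArg Subtype.val hj)⟩
    | path0 i j =>
      have h : u ∈ children c par (P i j 0) := hmem
      rw [hP0, hP1, Finset.mem_singleton] at h
      exact ⟨Sum.inr (Sum.inr (Sum.inl ⟨i, j, 1⟩)), h.symm⟩
    | path1 i j =>
      have h : u ∈ children c par (P i j 1) := hmem
      rw [hP2, Finset.mem_singleton] at h
      exact ⟨Sum.inr (Sum.inr (Sum.inl ⟨i, j, 2⟩)), h.symm⟩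
    | path2 i j =>
      have h : u ∈ children c par (P i j 2) := hmem
      rw [hP3] at h
      exact absurd h (Finset.notMem_empty u)
    | star0 i j =>
      have h : u ∈ children c par (S i j 0) := hmem
      rw [hS0, hS1, Finset.mem_insert, Finset.mem_singleton] at h
      rcases h with h | h
      · exact ⟨Sum.inr (Sum.inr (Sum.inr ⟨i, j, 1⟩)), h.symm⟩
      · exact ⟨Sum.inr (Sum.inr (Sum.inr ⟨i, j, 2⟩)), h.symm⟩
    | star1 i j =>
      have h : u ∈ children c par (S i j 1) := hmem
      rw [hS2] at h
      exact absurd h (Finset.notMem_empty u)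
    | star2 i j =>
      have h : u ∈ children c par (S i j 2) := hmem
      rw [hS3] at h
      exact absurd h (Finset.notMem_empty u)
  have hbij : Function.Bijective φ := by
    refine (Fintype.bijective_iff_surjective_and_card φ).2 ⟨hsurj, ?_⟩
    rw [hcard, card_Vtx fun i => by rw [← hstars, hsplit]]
  refine ⟨fun i => (paths i).card, fun i => ?_, Equiv.ofBijective φ hbij, rfl, hφ⟩
  exact hsplit i ▸ Nat.le_add_right _ _

/-- The sizes of the proper subtrees, together with their frequencies, force the two upper levels
of the tree. -/
theorem children_sizes (hT : IsRootedTree G c par d) {α n : ℕ} (hα : 0 < α) (hn : 2 ≤ n)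
    (hcard : Fintype.card V = 1 + n * (3 * α + 1))
    (hmem : ∀ v, v ≠ c → subtreeSize par v ∈ ({1, 2, 3, 3 * α + 1} : Finset ℕ))
    (hbig : (Finset.univ.filter fun v => subtreeSize par v = 3 * α + 1).card = n)
    (hthree : (Finset.univ.filter fun v => subtreeSize par v = 3).card = n * α) :
    (∀ u ∈ children c par c, subtreeSize par u = 3 * α + 1) ∧
      ∀ v ∈ children c par c, ∀ u ∈ children c par v, subtreeSize par u = 3 := by
  have hroot := hT.subtreeSize_root
  have hlt : 3 * α + 1 < Fintype.card V := by nlinarith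
  simp only [Finset.mem_insert, Finset.mem_singleton] at hmem
  have hle : ∀ v, v ≠ c → subtreeSize par v ≤ 3 * α + 1 := fun v hv => by
    have := hmem v hv
    omega
  have hproper : (Finset.univ.filter fun v => subtreeSize par v ≤ 3 * α + 1) =
      Finset.univ.erase c := by
    ext v
    simp only [Finset.mem_filter, Finset.mem_univ, true_and, Finset.mem_erase, and_true]
    refine ⟨?_, hle v⟩
    rintro h rfl
    omega
  have hsmall : (Finset.univ.filter fun v => subtreeSize par v ≤ 3).card + n =
      (Finset.univ.filter fun v => subtreeSize par v ≤ 3 * α + 1).card := by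
    rw [← hbig, ← Finset.card_union_of_disjoint]
    · congr 1
      ext v
      simp only [Finset.mem_union, Finset.mem_filter, Finset.mem_univ, true_and]
      by_cases hv : v = c
      · subst hv
        omega
      · have := hmem v hv
        omega
    · refine Finset.disjoint_left.2 fun v h h' => ?_
      simp only [Finset.mem_filter, Finset.mem_univ, true_and] at h h'
      omega
  have hproper_card : (Finset.univ.filter fun v => subtreeSize par v ≤ 3 * α + 1).card =
      n * (3 * α + 1) := by
    rw [hproper, Finset.card_erase_of_mem (Finset.mem_univ c), Finset.card_univ, hcard]
    omega
  have hchild : ∀ u ∈ children c par c, subtreeSize par u = 3 * α + 1 := by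
    intro u hu
    rw [mem_children] at hu
    refine hT.subtreeSize_eq_of_child ?_ (hle u hu.1) (by rw [hu.2, hroot]; exact hlt)
    rw [hproper_card, hbig]
  refine ⟨hchild, fun v hv u hu => ?_⟩
  have hvs := hchild v hv
  rw [mem_children] at hu
  have hus := hT.subtreeSize_lt hu.1
  rw [hu.2, hvs] at hus
  have := hmem u hu.1
  refine hT.subtreeSize_eq_of_child ?_ (by omega) (by rw [hu.2, hvs]; omega)
  rw [hthree]
  nlinarith

end IsRootedTree

/-- If `T = T_α(p)` with `β = Σ_i p_i`, and `T'` is any tree with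
`U_1(T) = U_1(T')`, then `T'` is a PTE-tree of the form `T_α(p')` for some
`α`-compatible sequence `p'` of the same length with `Σ_i p'_i = β`. -/
theorem U1_determines_PTE_shape {V' : Type} [Fintype V'] (α n : ℕ) (hα : 0 < α)
    (p : Fin n → ℕ) (hp : AlphaCompatible α p)
    (G' : SimpleGraph V') (hG' : G'.IsTree)
    (h : UkPoly (Ttree α p) 1 = UkPoly G' 1) :
    ∃ p' : Fin n → ℕ, AlphaCompatible α p' ∧ (∑ i, p' i) = (∑ i, p i) ∧
      Nonempty (G' ≃g Ttree α p') := by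
  obtain ⟨hn, hpα⟩ := hp
  have hps : ∀ i, p i + (α - p i) = α := fun i => Nat.add_sub_cancel' (hpα i)
  have hT := isRootedTree_TpsGraph n p fun i => α - p i
  have hcardT := card_Vtx hps
  have hlt : 2 * (3 * α + 1) < Fintype.card (Vtx n p fun i => α - p i) := by
    rw [hcardT]
    nlinarith
  have hsum : ∑ i, p i + ∑ i, (α - p i) = n * α := by
    rw [← Finset.sum_add_distrib, Finset.sum_congr rfl fun i _ => hps i]
    simp
  have hhalf : ∀ v, v ≠ Sum.inl () → 2 * subtreeSize (TpsParent n p fun i => α - p i) v ≤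
      Fintype.card (Vtx n p fun i => α - p i) := by
    intro v hv
    have hmem := subtreeSize_Tps_mem hps hv
    simp only [Finset.mem_insert, Finset.mem_singleton] at hmem
    omega
  obtain ⟨c, par, hT', hhalf'⟩ := hG'.exists_isRootedTree_centroid
  obtain ⟨hcard, hmap⟩ := hT.map_subtreeSize_eq hhalf hT' hhalf' h
  have hcount := fun {w : ℕ} => hT.card_subtreeSize_eq hT' hcard hmap (w := w)
  have hmem' : ∀ v, v ≠ c → subtreeSize par v ∈ ({1, 2, 3, 3 * α + 1} : Finset ℕ) := by
    intro v hv
    have hv' := Multiset.mem_map_of_mem (subtreeSize par)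
      (Finset.mem_filter.2 ⟨Finset.mem_univ v, hv⟩ : v ∈ Finset.univ.filter (· ≠ c))
    rw [← hmap] at hv'
    obtain ⟨u, hu, huv⟩ := Multiset.mem_map.1 hv'
    rw [← huv]
    exact subtreeSize_Tps_mem hps (by simpa using hu)
  have hne : 3 * α ≠ 2 := by omega
  have hbig : (Finset.univ.filter fun v => subtreeSize par v = 3 * α + 1).card = n := by
    rw [← hcount (by omega), card_subtreeSize_Tps hps (by omega)]
    simp [hα.ne', hne]
  have hthree : (Finset.univ.filter fun v => subtreeSize par v = 3).card = n * α := by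
    rw [← hcount (by omega), card_subtreeSize_Tps hps (by omega)]
    simp [hne, hsum]
  have htwo : ∀ q : Fin n → ℕ, (∀ i, q i + (α - q i) = α) →
      (Finset.univ.filter fun v => subtreeSize (TpsParent n q fun i => α - q i) v = 2).card =
        ∑ i, q i := by
    intro q hq
    have := card_Vtx hq
    rw [card_subtreeSize_Tps hq (by omega)]
    simp
  obtain ⟨hroot, hlevel⟩ := hT'.children_sizes hα hn (hcard ▸ hcardT) hmem' hbig hthree
  obtain ⟨q, hq, φ, hφc, hφ⟩ := hT'.exists_equiv_Vtx (hcard ▸ hcardT) hroot hlevel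
  refine ⟨q, ⟨hn, hq⟩, ?_,
    ⟨((isRootedTree_TpsGraph n q fun i => α - q i).iso hT' φ hφc hφ).symm⟩⟩
  rw [← htwo p hps, ← htwo q fun i => Nat.add_sub_cancel' (hq i), hcount (by omega)]
  refine Finset.card_equiv φ fun x => ?_
  simp only [Finset.mem_filter, Finset.mem_univ, true_and, subtreeSize_equiv φ hφ]
end

section
/- Let T be a tree with a unique centroid c, rooted at c, with edges labeled by θ. Then: (1) the labels along any path in T starting at the centroid are strictly decreasing; (2) for each edge e, θ_e equals one plus the sum of the labels of the child-edges of e; and (3) any two distinct edges with the same label repel each other. -/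
open scoped Classical

/-- The label `θ_e` of an edge of a tree: the smaller of the two component sizes
obtained after removing the edge. -/
noncomputable def edgeLabel {V : Type} [Fintype V] (G : SimpleGraph V) (e : Sym2 V) : ℕ :=
  sInf {m | m ∈ componentSizes (G.deleteEdges {e})}

/-- The branch-weight of a vertex: the maximum number of edges of a subtree of `G`
(i.e. a connected subgraph of the tree `G`) having `v` as a leaf. -/
noncomputable def branchWeight {V : Type} [Fintype V] (G : SimpleGraph V) (v : V) : ℕ :=
  sSup {m | ∃ S : G.Subgraph, S.Connected ∧ v ∈ S.verts ∧
    (S.neighborSet v).ncard = 1 ∧ S.edgeSet.ncard = m}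

/-- The centroid: the set of vertices of minimum branch-weight. -/
def centroid {V : Type} [Fintype V] (G : SimpleGraph V) : Set V :=
  {v | ∀ u, branchWeight G v ≤ branchWeight G u}

/-- Two edges `e` and `f` attract (w.r.t. the centroid `c`) if the unique path
joining `e` to `c` passes through `f`, or the unique path joining `f` to `c`
passes through `e`; here the path joining an edge to `c` is the path starting at
`c` whose last edge is that edge. -/
def Attract {V : Type} (G : SimpleGraph V) (c : V) (e f : Sym2 V) : Prop :=
  (∃ (u : V) (W : G.Walk c u), W.IsPath ∧ W.edges.getLast? = some e ∧ f ∈ W.edges) ∨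
  (∃ (u : V) (W : G.Walk c u), W.IsPath ∧ W.edges.getLast? = some f ∧ e ∈ W.edges)

/-- The branch at `u` in the direction of `v`: the vertices joined to `v` by a path avoiding `u`. -/
def branch {V : Type} (G : SimpleGraph V) (u v : V) : Set V :=
  {w | ∃ p : G.Walk v w, p.IsPath ∧ u ∉ p.support}

section Branch

variable {V : Type} {G : SimpleGraph V}

theorem SimpleGraph.IsAcyclic.isPath_unique (hG : G.IsAcyclic) {u v : V} {p q : G.Walk u v}
    (hp : p.IsPath) (hq : q.IsPath) : p = q :=
  congrArg Subtype.val ((hG.subsingleton_path u v).elim ⟨p, hp⟩ ⟨q, hq⟩)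

theorem mem_branch_self {u v : V} (h : u ≠ v) : v ∈ branch G u v :=
  ⟨.nil, .nil, by simpa using h⟩

theorem notMem_branch {u v : V} : u ∉ branch G u v := by
  rintro ⟨p, -, hp⟩
  exact hp p.end_mem_support

theorem mem_branch_of_mem_support {u v w x : V} {p : G.Walk v w} (hp : p.IsPath)
    (hu : u ∉ p.support) (hx : x ∈ p.support) : x ∈ branch G u v :=
  ⟨p.takeUntil x hx, hp.takeUntil hx, fun h => hu (p.support_takeUntil_subset_support hx h)⟩

/-- Branches at `u` in different directions are disjoint. -/
theorem eq_of_mem_branch (hG : G.IsAcyclic) {u v w x : V} (hv : G.Adj u v) (hw : G.Adj u w)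
    (hxv : x ∈ branch G u v) (hxw : x ∈ branch G u w) : v = w := by
  obtain ⟨p, hp, hup⟩ := hxv
  obtain ⟨q, hq, huq⟩ := hxw
  have h := hG.isPath_unique (hp.cons hup (h := hv)) (hq.cons huq (h := hw))
  simpa using congrArg SimpleGraph.Walk.snd h

theorem branch_eq_compl (hG : G.IsTree) {u v : V} (h : G.Adj u v) :
    branch G u v = (branch G v u)ᶜ := by
  ext w
  constructor
  · rintro ⟨p, hp, hup⟩ ⟨q, hq, hvq⟩
    have := hG.isAcyclic.isPath_unique (hp.cons hup (h := h)) hq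
    apply hvq
    simp [← this]
  · intro hw
    obtain ⟨p, hp⟩ := hG.connected.exists_isPath v w
    refine ⟨p, hp, fun hu => hw ⟨p.dropUntil u hu, hp.dropUntil hu, fun hv => ?_⟩⟩
    rw [← p.take_spec hu] at hp
    exact hp.ne_of_mem_support_of_append h.ne' (SimpleGraph.Walk.start_mem_support _) hv rfl

theorem branch_eq_insert (hG : G.IsAcyclic) {u v : V} (h : G.Adj u v) :
    branch G u v = insert v (⋃ w ∈ G.neighborSet v \ {u}, branch G v w) := by
  ext x
  simp only [Set.mem_insert_iff, Set.mem_iUnion, Set.mem_sdiff, SimpleGraph.mem_neighborSet,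
    Set.mem_singleton_iff, exists_prop]
  constructor
  · rintro ⟨p, hp, hup⟩
    cases p with
    | nil => exact .inl rfl
    | cons hvw q =>
      rw [SimpleGraph.Walk.cons_isPath_iff] at hp
      refine .inr ⟨_, ⟨hvw, ?_⟩, q, hp⟩
      rintro rfl
      simp at hup
  · rintro (rfl | ⟨w, ⟨hvw, hwu⟩, p, hp, hvp⟩)
    · exact mem_branch_self h.ne
    · refine ⟨.cons hvw p, hp.cons hvp, ?_⟩
      simp only [SimpleGraph.Walk.support_cons, List.mem_cons, h.ne, false_or]
      intro hu
      exact hwu (eq_of_mem_branch hG hvw h.symm (mem_branch_of_mem_support hp hvp hu)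
        (mem_branch_self h.ne'))

theorem connected_induce_insert_branch {v w : V} (h : G.Adj v w) :
    ((⊤ : G.Subgraph).induce (insert v (branch G v w))).Connected := by
  have hreach : ∀ x ∈ insert v (branch G v w), ∃ p : G.Walk w x,
      ∀ y ∈ p.support, y ∈ insert v (branch G v w) := by
    rintro x (rfl | ⟨p, hp, hvp⟩)
    · refine ⟨h.symm.toWalk, ?_⟩
      simp [SimpleGraph.Adj.toWalk, mem_branch_self h.ne]
    · exact ⟨p, fun y hy => .inr (mem_branch_of_mem_support hp hvp hy)⟩
  rw [← SimpleGraph.connected_induce_iff]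
  refine SimpleGraph.induce_connected_of_patches w (.inr (mem_branch_self h.ne)) fun hx => ?_
  obtain ⟨p, hp⟩ := hreach _ hx
  exact ⟨_, subset_rfl, .inr (mem_branch_self h.ne), hx, (p.induce _ hp).reachable⟩

theorem reachable_deleteEdges_iff (hG : G.IsAcyclic) {u v w : V} (h : G.Adj u v) :
    (G.deleteEdges {s(u, v)}).Reachable v w ↔ w ∈ branch G u v := by
  constructor
  · intro hr
    obtain ⟨p, hp⟩ := hr.exists_isPath
    refine ⟨p.mapLe (G.deleteEdges_le _), hp.mapLe _, fun hu => ?_⟩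
    have hq := hG.isPath_unique ((hp.mapLe (G.deleteEdges_le _)).takeUntil hu) h.symm.isPath_toWalk
    have hmem : s(u, v) ∈ (p.mapLe (G.deleteEdges_le _)).edges := by
      apply SimpleGraph.Walk.edges_takeUntil_subset_edges _ hu
      rw [hq]
      simp [SimpleGraph.Adj.toWalk, Sym2.eq_swap]
    rw [SimpleGraph.Walk.edges_mapLe_eq_edges] at hmem
    simpa using p.edges_subset_edgeSet hmem
  · rintro ⟨p, -, hup⟩
    refine (p.toDeleteEdges {s(u, v)} fun e he => ?_).reachable
    rintro rfl
    exact hup (p.fst_mem_support_of_mem_edges he)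

end Branch

section Fintype

variable {V : Type} [Fintype V] {G : SimpleGraph V}

theorem ncard_branch_add (hG : G.IsTree) {u v : V} (h : G.Adj u v) :
    (branch G u v).ncard + (branch G v u).ncard = Fintype.card V := by
  rw [branch_eq_compl hG h, add_comm, Set.ncard_add_ncard_compl, Nat.card_eq_fintype_card]

theorem ncard_branch (hG : G.IsAcyclic) {u v : V} (h : G.Adj u v) :
    (branch G u v).ncard =
      (∑ w ∈ (G.neighborFinset v).erase u, (branch G v w).ncard) + 1 := by
  have hset : branch G u v =
      ↑(insert v (((G.neighborFinset v).erase u).biUnion fun w => (branch G v w).toFinset)) := by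
    rw [branch_eq_insert hG h]
    ext x
    simp [and_comm]
  rw [hset, Set.ncard_coe_finset, Finset.card_insert_of_notMem, Finset.card_biUnion]
  · simp [Set.ncard_eq_toFinset_card']
  · intro x hx y hy hxy
    refine Finset.disjoint_left.2 fun a hax hay => ?_
    simp only [Finset.coe_erase, Set.mem_sdiff, Finset.mem_coe,
      SimpleGraph.mem_neighborFinset] at hx hy
    rw [Set.mem_toFinset] at hax hay
    exact hxy (eq_of_mem_branch hG hx.1 hy.1 hax hay)
  · simp [notMem_branch]

theorem ncard_branch_lt (hG : G.IsAcyclic) {u v w : V} (h : G.Adj u v) (hw : G.Adj v w)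
    (hne : w ≠ u) : (branch G v w).ncard < (branch G u v).ncard := by
  rw [ncard_branch hG h, Nat.lt_succ_iff]
  exact Finset.single_le_sum (f := fun w => (branch G v w).ncard) (fun _ _ => Nat.zero_le _)
    (by simp [hne, hw])

theorem edgeLabel_eq_min (hG : G.IsTree) {u v : V} (h : G.Adj u v) :
    edgeLabel G s(u, v) = min (branch G u v).ncard (branch G v u).ncard := by
  have hsupp : ∀ {a b : V}, G.Adj a b → s(a, b) = s(u, v) →
      Nat.card ((G.deleteEdges {s(u, v)}).connectedComponentMk b).supp =
        (branch G a b).ncard := by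
    intro a b hab he
    rw [Nat.card_coe_set_eq]
    congr 1
    ext w
    rw [SimpleGraph.ConnectedComponent.mem_supp_iff, SimpleGraph.ConnectedComponent.eq, ← he,
      SimpleGraph.reachable_comm, reachable_deleteEdges_iff hG.isAcyclic hab]
  have hset : {m | m ∈ componentSizes (G.deleteEdges {s(u, v)})} =
      {(branch G u v).ncard, (branch G v u).ncard} := by
    ext m
    simp only [componentSizes, Multiset.mem_map, Finset.mem_val, Finset.mem_univ, true_and,
      Set.mem_ofPred_eq, Set.mem_insert_iff, Set.mem_singleton_iff]
    constructor
    · rintro ⟨C, rfl⟩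
      induction C using SimpleGraph.ConnectedComponent.ind with
      | h w =>
        by_cases hw : w ∈ branch G u v
        · left
          rw [← hsupp h rfl, SimpleGraph.ConnectedComponent.sound
            ((reachable_deleteEdges_iff hG.isAcyclic h).2 hw)]
        · right
          rw [branch_eq_compl hG h, Set.notMem_compl_iff,
            ← reachable_deleteEdges_iff hG.isAcyclic h.symm, Sym2.eq_swap] at hw
          rw [← hsupp h.symm Sym2.eq_swap, SimpleGraph.ConnectedComponent.sound hw]
    · rintro (rfl | rfl)
      · exact ⟨_, hsupp h rfl⟩
      · exact ⟨_, hsupp h.symm Sym2.eq_swap⟩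
  rw [edgeLabel, hset, csInf_pair]

theorem edgeLabel_eq_ncard_branch (hG : G.IsTree) {u v : V} (h : G.Adj u v)
    (hle : 2 * (branch G u v).ncard ≤ Fintype.card V) :
    edgeLabel G s(u, v) = (branch G u v).ncard := by
  rw [edgeLabel_eq_min hG h, min_eq_left]
  have := ncard_branch_add hG h
  omega

theorem ncard_edgeSet_add_one (hG : G.IsAcyclic) {S : G.Subgraph} (hS : S.Connected) :
    S.edgeSet.ncard + 1 = S.verts.ncard := by
  have hT : S.coe.IsTree := ⟨hS.coe, hG.subgraph S⟩
  have h := hT.card_edgeFinset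
  rw [← S.image_coe_edgeSet_coe,
    Set.ncard_image_of_injective _ (Sym2.map.injective Subtype.val_injective),
    Set.ncard_eq_toFinset_card', ← Nat.card_coe_set_eq, Nat.card_eq_fintype_card]
  exact h

theorem ncard_edgeSet_le (hG : G.IsAcyclic) {S : G.Subgraph} (hS : S.Connected) {v : V}
    (hv : v ∈ S.verts) (hleaf : (S.neighborSet v).ncard = 1) :
    ∃ w, G.Adj v w ∧ S.edgeSet.ncard ≤ (branch G v w).ncard := by
  obtain ⟨w, hw⟩ := Set.ncard_eq_one.1 hleaf
  have hvw : S.Adj v w := by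
    rw [← S.mem_neighborSet, hw]
    rfl
  refine ⟨w, hvw.adj_sub, ?_⟩
  have hsub : S.verts ⊆ insert v (branch G v w) := by
    intro a ha
    obtain ⟨p, hp⟩ := hS.coe.exists_isPath ⟨v, hv⟩ ⟨a, ha⟩
    cases p with
    | nil => exact .inl rfl
    | @cons _ b _ h q =>
      have hb : (b : V) ∈ S.neighborSet v := h
      rw [hw, Set.mem_singleton_iff] at hb
      have hp' := hp.map S.hom_injective
      rw [SimpleGraph.Walk.map_cons, SimpleGraph.Walk.cons_isPath_iff] at hp'
      subst hb
      exact .inr ⟨_, hp'⟩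
  have h1 := ncard_edgeSet_add_one hG hS
  have h2 := Set.ncard_le_ncard hsub
  rw [Set.ncard_insert_of_notMem notMem_branch] at h2
  omega

theorem branchWeight_le (hG : G.IsAcyclic) {v : V} {n : ℕ}
    (h : ∀ w, G.Adj v w → (branch G v w).ncard ≤ n) : branchWeight G v ≤ n := by
  refine csSup_le' ?_
  rintro m ⟨S, hS, hv, hleaf, rfl⟩
  obtain ⟨w, hw, hle⟩ := ncard_edgeSet_le hG hS hv hleaf
  exact hle.trans (h w hw)

theorem ncard_branch_le_branchWeight (hG : G.IsAcyclic) {v w : V} (h : G.Adj v w) :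
    (branch G v w).ncard ≤ branchWeight G v := by
  have hconn := connected_induce_insert_branch h
  refine le_csSup ⟨Fintype.card V, ?_⟩
    ⟨(⊤ : G.Subgraph).induce (insert v (branch G v w)), hconn, ?_, ?_, ?_⟩
  · rintro m ⟨S, hS, hv, hleaf, rfl⟩
    obtain ⟨x, -, hle⟩ := ncard_edgeSet_le hG hS hv hleaf
    exact hle.trans ((Set.ncard_le_card _).trans_eq Nat.card_eq_fintype_card)
  · exact Set.mem_insert _ _
  · rw [Set.ncard_eq_one]
    refine ⟨w, Set.ext fun x => ?_⟩
    simp only [SimpleGraph.Subgraph.mem_neighborSet, SimpleGraph.Subgraph.induce_adj,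
      SimpleGraph.Subgraph.top_adj, Set.mem_singleton_iff]
    constructor
    · rintro ⟨-, rfl | hx, hvx⟩
      · exact (G.irrefl hvx).elim
      · exact eq_of_mem_branch hG hvx h (mem_branch_self hvx.ne) hx
    · rintro rfl
      exact ⟨Set.mem_insert _ _, .inr (mem_branch_self h.ne), h⟩
  · have hcard := ncard_edgeSet_add_one hG hconn
    rw [SimpleGraph.Subgraph.induce_verts, Set.ncard_insert_of_notMem notMem_branch] at hcard
    omega

theorem two_mul_ncard_branch_le_of_mem_centroid (hG : G.IsTree) {c w : V} (hc : c ∈ centroid G)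
    (h : G.Adj c w) : 2 * (branch G c w).ncard ≤ Fintype.card V := by
  by_contra! hlt
  have hadd := ncard_branch_add hG h
  have hw : branchWeight G w ≤ (branch G c w).ncard - 1 := by
    refine branchWeight_le hG.isAcyclic fun x hx => ?_
    by_cases hxc : x = c
    · subst hxc
      omega
    · have := ncard_branch_lt hG.isAcyclic h hx hxc
      omega
  have h1 := ncard_branch_le_branchWeight hG.isAcyclic h
  have h2 := hc w
  omega

theorem two_mul_ncard_branch_le (hG : G.IsTree) {c u v : V} (hc : c ∈ centroid G)
    (h : G.Adj u v) (hd : G.dist c u < G.dist c v) :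
    2 * (branch G u v).ncard ≤ Fintype.card V := by
  induction hn : G.dist c u generalizing u v with
  | zero =>
    obtain rfl := hG.connected.dist_eq_zero_iff.1 hn
    exact two_mul_ncard_branch_le_of_mem_centroid hG hc h
  | succ n ih =>
    obtain ⟨p, hp⟩ := hG.connected.exists_walk_length_eq_dist u c
    cases p with
    | nil => simp at hn
    | @cons _ t _ hut q =>
      have htu := SimpleGraph.dist_le q
      rw [SimpleGraph.Walk.length_cons, SimpleGraph.dist_comm, hn] at hp
      have := hG.connected.dist_triangle (u := c) (v := t) (w := u)
      rw [SimpleGraph.dist_eq_one_iff_adj.2 hut.symm] at this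
      rw [SimpleGraph.dist_comm] at htu
      have hvt : v ≠ t := by
        rintro rfl
        omega
      have h1 := ncard_branch_lt hG.isAcyclic hut.symm h hvt
      have h2 := ih hut.symm (by omega) (by omega)
      omega

theorem isChain_edgeLabel_cons (hG : G.IsTree) {u v x : V} (h : G.Adj u v) {p : G.Walk v x}
    (hp : (SimpleGraph.Walk.cons h p).IsPath)
    (hle : 2 * (branch G u v).ncard ≤ Fintype.card V) :
    (SimpleGraph.Walk.cons h p).edges.IsChain fun e f => edgeLabel G f < edgeLabel G e := by
  induction p generalizing u with
  | nil => simp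
  | @cons v w _ hvw q ih =>
    have hwu : w ≠ u := by
      rintro rfl
      simp [SimpleGraph.Walk.cons_isPath_iff] at hp
    have hlt := ncard_branch_lt hG.isAcyclic h hvw hwu
    have hle' : 2 * (branch G v w).ncard ≤ Fintype.card V := by omega
    have hchain := ih hvw hp.of_cons hle'
    rw [SimpleGraph.Walk.edges_cons] at hchain ⊢
    rw [SimpleGraph.Walk.edges_cons, List.isChain_cons_cons]
    refine ⟨?_, hchain⟩
    rwa [edgeLabel_eq_ncard_branch hG h hle, edgeLabel_eq_ncard_branch hG hvw hle']

theorem isChain_edgeLabel (hG : G.IsTree) {c u : V} (hc : c ∈ centroid G) {p : G.Walk c u}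
    (hp : p.IsPath) : p.edges.IsChain fun e f => edgeLabel G f < edgeLabel G e := by
  cases p with
  | nil => simp
  | cons h q =>
    exact isChain_edgeLabel_cons hG h hp (two_mul_ncard_branch_le_of_mem_centroid hG hc h)

theorem edgeLabel_lt_of_getLast (hG : G.IsTree) {c u : V} (hc : c ∈ centroid G) {p : G.Walk c u}
    (hp : p.IsPath) {e f : Sym2 V} (he : p.edges.getLast? = some e) (hf : f ∈ p.edges)
    (hne : e ≠ f) : edgeLabel G e < edgeLabel G f := by
  have : IsTrans (Sym2 V) fun e f => edgeLabel G f < edgeLabel G e :=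
    ⟨fun _ _ _ h1 h2 => h2.trans h1⟩
  have hpair := (isChain_edgeLabel hG hc hp).pairwise
  obtain ⟨l, hl⟩ := List.getLast?_eq_some_iff.1 he
  rw [hl, List.pairwise_append] at hpair
  rw [hl, List.mem_append, List.mem_singleton] at hf
  exact hpair.2.2 f (hf.resolve_right hne.symm) e (by simp)

end Fintype

/-- In a tree with a unique centroid `c`: (1) edge labels strictly decrease along any
path starting at `c`; (2) the label of an edge is one plus the sum of the labels of
its child-edges; (3) two distinct edges with the same label repel. -/
theorem centroid_label_lemma {V : Type} [Fintype V] (G : SimpleGraph V)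
    (hG : G.IsTree) (c : V) (hc : centroid G = {c}) :
    (∀ (u : V) (W : G.Walk c u), W.IsPath →
      List.Chain' (fun e f => edgeLabel G f < edgeLabel G e) W.edges) ∧
    (∀ u v : V, G.Adj u v → G.dist c u < G.dist c v →
      edgeLabel G s(u, v) =
        (∑ w ∈ (G.neighborFinset v).erase u, edgeLabel G s(v, w)) + 1) ∧
    (∀ e f : Sym2 V, e ∈ G.edgeSet → f ∈ G.edgeSet → e ≠ f →
      edgeLabel G e = edgeLabel G f → ¬ Attract G c e f) := by
  have hmem : c ∈ centroid G := by
    rw [hc]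
    rfl
  refine ⟨fun u W hW => isChain_edgeLabel hG hmem hW, fun u v h hd => ?_, ?_⟩
  · have hle := two_mul_ncard_branch_le hG hmem h hd
    rw [edgeLabel_eq_ncard_branch hG h hle, ncard_branch hG.isAcyclic h]
    congr 1
    refine Finset.sum_congr rfl fun w hw => ?_
    rw [Finset.mem_erase, SimpleGraph.mem_neighborFinset] at hw
    have hlt := ncard_branch_lt hG.isAcyclic h hw.2 hw.1
    exact (edgeLabel_eq_ncard_branch hG hw.2 (by omega)).symm
  · rintro e f - - hne heq (⟨u, W, hW, hlast, hf⟩ | ⟨u, W, hW, hlast, he⟩)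
    · exact (edgeLabel_lt_of_getLast hG hmem hW hlast hf hne).ne heq
    · exact (edgeLabel_lt_of_getLast hG hmem hW hlast he hne.symm).ne heq.symm
end

section
/- If p = (p_1,…,p_n) and p' = (p'_1,…,p'_n) are integer sequences of the same length n that are not permutations of each other and satisfy p =_k p' for a positive integer k, then n > k. Equivalently, any nontrivial solution of the Prouhet–Tarry–Escott problem of degree k has size at least k+1. -/
open scoped Classical

/-- `a =_k b` : the power sums of orders `1,…,k` of the two sequences agree. -/
def PTErel (k : ℕ) {n : ℕ} {R : Type*} [CommSemiring R] (a b : Fin n → R) : Prop :=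
  ∀ ℓ : ℕ, 1 ≤ ℓ → ℓ ≤ k → ∑ i, (a i) ^ ℓ = ∑ i, (b i) ^ ℓ

/-- By Newton's identities, over a domain of characteristic zero the first `k` power sums
determine the first `k` elementary symmetric functions. -/
theorem PTErel.esymm_eq {R : Type*} [CommRing R] [IsDomain R] [CharZero R] {k n : ℕ}
    {a b : Fin n → R} (h : PTErel k a b) {m : ℕ} (hm : m ≤ k) :
    (Finset.univ.val.map a).esymm m = (Finset.univ.val.map b).esymm m := by
  induction m using Nat.strong_induction_on with
  | _ m ih =>
    rcases Nat.eq_zero_or_pos m with rfl | hpos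
    · simp [Multiset.esymm]
    have newton (c : Fin n → R) := congrArg (MvPolynomial.aeval c)
      (MvPolynomial.mul_esymm_eq_sum (Fin n) R m)
    simp only [map_mul, map_natCast, map_pow, map_neg, map_one, map_sum, MvPolynomial.psum,
      MvPolynomial.aeval_X, MvPolynomial.aeval_esymm_eq_multiset_esymm] at newton
    refine mul_left_cancel₀ (Nat.cast_ne_zero.mpr hpos.ne' : (m : R) ≠ 0) ?_
    rw [newton a, newton b]
    congr 1
    refine Finset.sum_congr rfl fun x hx => ?_
    simp only [Finset.mem_filter, Finset.HasAntidiagonal.mem_antidiagonal] at hx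
    rw [ih x.1 hx.2 (by lia), h x.2 (by lia) (by lia)]

/-- Sequences of length `n ≤ k` over a domain of characteristic zero with the same first `k`
power sums are permutations of each other. -/
theorem PTErel.map_univ_eq {R : Type*} [CommRing R] [IsDomain R] [CharZero R] {k n : ℕ}
    {a b : Fin n → R} (h : PTErel k a b) (hn : n ≤ k) :
    Finset.univ.val.map a = Finset.univ.val.map b := by
  rw [← Polynomial.roots_multiset_prod_X_sub_C (Finset.univ.val.map a),
    ← Polynomial.roots_multiset_prod_X_sub_C (Finset.univ.val.map b),
    Multiset.prod_X_sub_X_eq_sum_esymm, Multiset.prod_X_sub_X_eq_sum_esymm]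
  congr 1
  simp only [Multiset.card_map, Finset.card_val, Finset.card_univ, Fintype.card_fin]
  refine Finset.sum_congr rfl fun j hj => ?_
  rw [h.esymm_eq (by have := Finset.mem_range.mp hj; lia)]

/-- Any nontrivial solution of the Prouhet–Tarry–Escott problem of degree `k` has
size greater than `k`: if `p` and `p'` are integer sequences of length `n` that are
not permutations of each other and `p =_k p'`, then `n > k`. -/
theorem PTE_size_gt_degree (k n : ℕ) (hk : 0 < k) (p p' : Fin n → ℤ)
    (hdist : Multiset.map p Finset.univ.val ≠ Multiset.map p' Finset.univ.val)
    (h : PTErel k p p') : k < n := by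
  by_contra hlt
  exact hdist (h.map_univ_eq (not_lt.mp hlt))
end

section
/- Let k be a positive integer and let p = (p_1,…,p_n) and p' = (p'_1,…,p'_n) be non-negative integer sequences with p =_k p'. Then the polynomial (x−1)^{k+1} divides Σ_{i=1}^n (x^{p_i} − x^{p'_i}) in ℤ[x]. Consequently, if p and p' are not permutations of each other, then k+1 ≤ max{max_i p_i, max_i p'_i}. -/
open scoped Classical

open Polynomial in
/-- Sequences with equal power sums up to order `k` have equal sums of values of every
polynomial of degree at most `k`. -/
theorem PTErel.sum_eval_eq {k n : ℕ} {R : Type*} [CommSemiring R] {a b : Fin n → R}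
    (h : PTErel k a b) {q : R[X]} (hq : q.natDegree ≤ k) :
    ∑ i, q.eval (a i) = ∑ i, q.eval (b i) := by
  simp only [eval_eq_sum_range' (Nat.lt_succ_of_le hq)]
  rw [Finset.sum_comm, Finset.sum_comm (s := Finset.univ)]
  refine Finset.sum_congr rfl fun ℓ hℓ => ?_
  rw [← Finset.mul_sum, ← Finset.mul_sum]
  rcases Nat.eq_zero_or_pos ℓ with rfl | hpos
  · simp
  · rw [h ℓ hpos (Nat.lt_succ_iff.mp (Finset.mem_range.mp hℓ))]

theorem PTErel.natCast {k n : ℕ} (R : Type*) [CommSemiring R] {p p' : Fin n → ℕ}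
    (h : PTErel k p p') : PTErel k (fun i => (p i : R)) (fun i => (p' i : R)) := by
  intro ℓ h1 hk
  simpa using congrArg (Nat.cast : ℕ → R) (h ℓ h1 hk)

open Polynomial in
theorem PTErel.sum_choose_eq {k n : ℕ} {p p' : Fin n → ℕ} (h : PTErel k p p')
    {d : ℕ} (hd : d ≤ k) : ∑ i, (p i).choose d = ∑ i, (p' i).choose d := by
  have key := (h.natCast ℤ).sum_eval_eq (q := descPochhammer ℤ d)
    ((descPochhammer_natDegree ℤ d).trans_le hd)
  simp only [descPochhammer_eval_eq_descFactorial, Nat.descFactorial_eq_factorial_mul_choose]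
    at key
  have key' : d.factorial * ∑ i, (p i).choose d = d.factorial * ∑ i, (p' i).choose d := by
    rw [Finset.mul_sum, Finset.mul_sum]
    exact_mod_cast key
  exact Nat.eq_of_mul_eq_mul_left d.factorial_pos key'

open Polynomial in
theorem PTErel.X_sub_one_pow_dvd {k n : ℕ} {p p' : Fin n → ℕ} (h : PTErel k p p') :
    (X - 1 : ℤ[X]) ^ (k + 1) ∣ ∑ i, ((X : ℤ[X]) ^ (p i) - X ^ (p' i)) := by
  rw [← C_1, X_sub_C_pow_dvd_iff, X_pow_dvd_iff]
  intro d hd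
  have hc := h.sum_choose_eq (Nat.lt_succ_iff.mp hd)
  simp only [C_1, Polynomial.sum_comp, sub_comp, X_pow_comp, finsetSum_coeff, coeff_sub,
    coeff_X_add_one_pow, Finset.sum_sub_distrib]
  rw [sub_eq_zero]
  exact_mod_cast hc

open Polynomial in
theorem coeff_sum_X_pow_eq_count {n : ℕ} (R : Type*) [Semiring R] (p : Fin n → ℕ) (m : ℕ) :
    (∑ i, (X : R[X]) ^ (p i)).coeff m =
      ((Multiset.map p Finset.univ.val).count m : R) := by
  rw [Multiset.count_map]
  simp [coeff_X_pow, Finset.card_def]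

/-- If `p =_k p'` are non-negative integer sequences, then `(x−1)^(k+1)` divides
`Σ_i (x^(p_i) − x^(p'_i))` in `ℤ[x]`; consequently, if `p` and `p'` are not
permutations of each other, then `k + 1 ≤ max{max_i p_i, max_i p'_i}`. -/
theorem PTE_polynomial_divisibility (k n : ℕ) (hk : 0 < k) (p p' : Fin n → ℕ)
    (h : PTErel k p p') :
    ((Polynomial.X - 1 : Polynomial ℤ) ^ (k + 1) ∣
        ∑ i, ((Polynomial.X : Polynomial ℤ) ^ (p i) - Polynomial.X ^ (p' i))) ∧
    (Multiset.map p Finset.univ.val ≠ Multiset.map p' Finset.univ.val →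
      k + 1 ≤ max (Finset.univ.sup p) (Finset.univ.sup p')) := by
  refine ⟨h.X_sub_one_pow_dvd, fun hne => ?_⟩
  by_contra hlt
  push Not at hlt
  apply hne
  have hmonic : ((Polynomial.X - 1 : Polynomial ℤ) ^ (k + 1)).Monic := by
    simpa using (Polynomial.monic_X_sub_C (1 : ℤ)).pow (k + 1)
  have hdeg : ((Polynomial.X - 1 : Polynomial ℤ) ^ (k + 1)).natDegree = k + 1 := by
    rw [← Polynomial.C_1, Polynomial.natDegree_pow, Polynomial.natDegree_X_sub_C, mul_one]
  have hzero : ∑ i, ((Polynomial.X : Polynomial ℤ) ^ (p i) - Polynomial.X ^ (p' i)) = 0 := by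
    by_contra h0
    refine hmonic.not_dvd_of_natDegree_lt h0 ?_ h.X_sub_one_pow_dvd
    rw [hdeg]
    refine lt_of_le_of_lt (Polynomial.natDegree_sum_le_of_forall_le _ _ fun i _ => ?_) hlt
    refine (Polynomial.natDegree_sub_le _ _).trans ?_
    simp only [Polynomial.natDegree_X_pow]
    exact max_le_max (Finset.le_sup (Finset.mem_univ i)) (Finset.le_sup (Finset.mem_univ i))
  rw [Finset.sum_sub_distrib, sub_eq_zero] at hzero
  ext m
  have hcoeff := congrArg (fun f => Polynomial.coeff f m) hzero
  simp only [coeff_sum_X_pow_eq_count] at hcoeff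
  exact_mod_cast hcoeff
end
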